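/- arXiv:2506.12151 — 4 statements merged into one kernel-verified Lean document; each statement's English description precedes it below -/
import Mathlib

section
/- Let k and ℓ be integers with k, ℓ ≥ 2 and 2k ≥ ℓ, and let H be a finite simple graph on ℓ vertices that contains a Hamiltonian cycle. Then C(C_{2k}, H) = 4k(k−1)/(2kℓ−2k−ℓ). -/
open SimpleGraph

/-- The homomorphism density `t(G,T)`. -/
noncomputable def homDensity {α β : Type*} [Fintype α] [Fintype β]
    (G : SimpleGraph α) (T : SimpleGraph β) : ℝ :=
  (Nat.card (G →g T) : ℝ) / (Fintype.card β : ℝ) ^ (Fintype.card α)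
/-- The set of real exponents `c ≥ 0` such that `t(G,T) ≥ t(H,T)^c` for all
finite graphs `T` with at least one vertex. -/
def domSet {α β : Type*} [Fintype α] [Fintype β]
    (G : SimpleGraph α) (H : SimpleGraph β) : Set ℝ :=
  {c : ℝ | 0 ≤ c ∧ ∀ (n : ℕ), 0 < n → ∀ T : SimpleGraph (Fin n),
    homDensity H T ^ c ≤ homDensity G T}

/-- The homomorphism density domination exponent `C(G,H)`, as the infimum of `domSet G H`. -/
noncomputable def domExp {α β : Type*} [Fintype α] [Fintype β]
    (G : SimpleGraph α) (H : SimpleGraph β) : ℝ :=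
  sInf (domSet G H)

open Finset in
theorem path_sum {V : Type*} [Fintype V] [DecidableEq V] (A : Matrix V V ℝ) (m : ℕ)
    (g : V → V → ℝ) :
    ∑ f : Fin (m+1) → V, (∏ i : Fin m, A (f i.castSucc) (f i.succ)) * g (f 0) (f (Fin.last m))
      = ∑ u, ∑ v, (A ^ m) u v * g u v := by
  induction m generalizing g with
  | zero =>
    rw [← (Equiv.funUnique (Fin 1) V).symm.sum_comp]
    simp [Matrix.one_apply]
  | succ m ih =>
    rw [← (Fin.snocEquiv (fun _ : Fin (m+2) => V)).sum_comp, Fintype.sum_prod_type, sum_comm]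
    have h1 : ∀ (f : Fin (m+1) → V),
        ∑ x : V, (∏ i : Fin (m+1), A ((Fin.snocEquiv (fun _ : Fin (m+2) => V)) (x, f) i.castSucc)
          ((Fin.snocEquiv (fun _ : Fin (m+2) => V)) (x, f) i.succ)) *
          g ((Fin.snocEquiv (fun _ : Fin (m+2) => V)) (x, f) 0)
            ((Fin.snocEquiv (fun _ : Fin (m+2) => V)) (x, f) (Fin.last (m+1)))
        = (∏ i : Fin m, A (f i.castSucc) (f i.succ)) *
          (fun u v => ∑ x, A v x * g u x) (f 0) (f (Fin.last m)) := by
      intro f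
      simp only [mul_sum]
      refine sum_congr rfl fun x _ => ?_
      have e0 : (Fin.snoc f x : Fin (m+2) → V) 0 = f 0 := by
        rw [← Fin.castSucc_zero, Fin.snoc_castSucc (α := fun _ => V)]
      have e1 : ∀ i : Fin m, (Fin.snoc f x : Fin (m+2) → V) i.castSucc.succ = f i.succ := by
        intro i
        rw [Fin.succ_castSucc, Fin.snoc_castSucc (α := fun _ => V)]
      have e2 : ∀ i : Fin (m+1), (Fin.snoc f x : Fin (m+2) → V) i.castSucc = f i := by
        intro i
        rw [Fin.snoc_castSucc (α := fun _ => V)]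
      have e3 : (Fin.snoc f x : Fin (m+2) → V) (Fin.last (m+1)) = x := by
        rw [Fin.snoc_last (α := fun _ => V)]
      simp only [Fin.snocEquiv_apply, Fin.prod_univ_castSucc, e0, e1, e2, e3, Fin.succ_last]
      ring
    rw [sum_congr rfl fun f _ => h1 f]
    refine (ih (fun u v => ∑ x, A v x * g u x)).trans ?_
    refine sum_congr rfl fun u _ => ?_
    simp only [pow_succ, Matrix.mul_apply, mul_sum, sum_mul]
    rw [sum_comm]
    refine sum_congr rfl fun u _ => sum_congr rfl fun v _ => by ring

theorem cycle_sum {V : Type*} [Fintype V] [DecidableEq V] (A : Matrix V V ℝ) (m : ℕ) :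
    ∑ f : Fin (m+1) → V, ∏ i : Fin (m+1), A (f i) (f (i+1)) = (A ^ (m+1)).trace := by
  have := path_sum A m (fun u v => A v u)
  rw [pow_succ, Matrix.trace]
  simp only [Matrix.diag_apply, Matrix.mul_apply]
  rw [← this]
  refine Finset.sum_congr rfl fun f _ => ?_
  rw [Fin.prod_univ_castSucc]
  simp

noncomputable def adjM {V : Type*} (T : SimpleGraph V) : Matrix V V ℝ :=
  open Classical in fun x y => if T.Adj x y then 1 else 0

theorem hom_cycle {V : Type*} [Fintype V] [DecidableEq V] (T : SimpleGraph V) (m : ℕ)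
    (hm : 2 ≤ m) :
    (Nat.card (cycleGraph m →g T) : ℝ) = ((adjM T) ^ m).trace := by
  classical
  obtain ⟨n, rfl⟩ := Nat.exists_eq_add_of_le' hm
  rw [← cycle_sum (adjM T) (n+1)]
  have e : (cycleGraph (n+2) →g T) ≃ {f : Fin (n+2) → V // ∀ i, T.Adj (f i) (f (i+1))} :=
    { toFun := fun φ => ⟨φ, fun i => φ.map_adj (by rw [cycleGraph_adj]; right; simp)⟩
      invFun := fun f => ⟨f.1, by
        intro a b hab
        rw [cycleGraph_adj] at hab
        rcases hab with h | h
        · have : a = b + 1 := by rw [← h]; abel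
          rw [this]; exact (f.2 b).symm
        · have : b = a + 1 := by rw [← h]; abel
          rw [this]; exact (f.2 a)⟩
      left_inv := fun φ => rfl
      right_inv := fun f => rfl }
  rw [Nat.card_congr e, Nat.card_eq_fintype_card, Fintype.card_subtype]
  rw [Finset.card_filter]
  push_cast
  refine Finset.sum_congr rfl fun f _ => ?_
  simp only [adjM]
  rw [Finset.prod_ite_zero]
  simp

theorem spec {n : ℕ} (A : Matrix (Fin n) (Fin n) ℝ) (hA : A.transpose = A) :
    ∃ (U : Matrix (Fin n) (Fin n) ℝ) (z : Fin n → ℝ), U * U.transpose = 1 ∧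
      U.transpose * U = 1 ∧ A = U * Matrix.diagonal z * U.transpose := by
  have h : A.IsHermitian := by rw [Matrix.IsHermitian, Matrix.conjTranspose_eq_transpose_of_trivial, hA]
  refine ⟨h.eigenvectorUnitary, h.eigenvalues, ?_, ?_, ?_⟩
  · have := Unitary.coe_mul_star_self h.eigenvectorUnitary
    rwa [Unitary.coe_star, Matrix.star_eq_conjTranspose, Matrix.conjTranspose_eq_transpose_of_trivial] at this
  · have := Unitary.coe_star_mul_self h.eigenvectorUnitary
    rwa [Matrix.star_eq_conjTranspose, Matrix.conjTranspose_eq_transpose_of_trivial] at this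
  · have := h.spectral_theorem
    rw [Unitary.conjStarAlgAut_apply, Matrix.star_eq_conjTranspose,
      Matrix.conjTranspose_eq_transpose_of_trivial] at this
    exact this

theorem spec_pow {n : ℕ} (A U : Matrix (Fin n) (Fin n) ℝ) (z : Fin n → ℝ)
    (h2 : U.transpose * U = 1) (hA : A = U * Matrix.diagonal z * U.transpose)
    (h1 : U * U.transpose = 1) (m : ℕ) :
    (A ^ m).trace = ∑ i, z i ^ m := by
  have : A ^ m = U * Matrix.diagonal (z ^ m) * U.transpose := by
    induction m with
    | zero => simp [h1]
    | succ m ih =>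
      rw [pow_succ, ih, hA]
      calc _ = U * Matrix.diagonal (z^m) * (U.transpose * U) * Matrix.diagonal z * U.transpose := by
            simp only [Matrix.mul_assoc]
        _ = _ := by
            rw [h2, Matrix.mul_one, Matrix.mul_assoc U, Matrix.diagonal_mul_diagonal]
            rfl
  rw [this, Matrix.trace_mul_comm, ← Matrix.mul_assoc, h2, Matrix.one_mul, Matrix.trace_diagonal]
  rfl

/-- Sidorenko for even cycles, spectral form -/
theorem sid {n : ℕ} (hn : 0 < n) (A U : Matrix (Fin n) (Fin n) ℝ) (z : Fin n → ℝ)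
    (hA : A = U * Matrix.diagonal z * U.transpose)
    (h1 : U * U.transpose = 1) (m : ℕ) (hm : Even m) :
    ((∑ i, ∑ j, A i j) / n) ^ m ≤ ∑ i, z i ^ m := by
  have hn' : (0:ℝ) < n := by exact_mod_cast hn
  set u : Fin n → ℝ := fun j => ∑ i, U i j with hu
  have hs : ∑ j, u j ^ 2 = n := by
    have : ∑ i, ∑ i', (U * U.transpose) i i' = n := by
      rw [h1]; simp [Matrix.one_apply]
    rw [← this]
    simp only [hu, Matrix.mul_apply, Matrix.transpose_apply, sq, Finset.sum_mul_sum]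
    rw [Finset.sum_comm]
    exact Finset.sum_congr rfl fun i _ => Finset.sum_comm
  have hAu : ∑ i, ∑ j, A i j = ∑ j, u j ^ 2 * z j := by
    have h : ∀ i j, A i j = ∑ x, U i x * z x * U j x := by
      intro i j
      rw [hA, Matrix.mul_apply]
      simp only [Matrix.mul_diagonal, Matrix.transpose_apply]
    calc ∑ i, ∑ j, A i j = ∑ i, ∑ j, ∑ x, U i x * z x * U j x := by simp only [h]
      _ = ∑ i, ∑ x, ∑ j, U i x * z x * U j x := Finset.sum_congr rfl fun i _ => Finset.sum_comm
      _ = ∑ x, ∑ i, ∑ j, U i x * z x * U j x := Finset.sum_comm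
      _ = _ := by
        refine Finset.sum_congr rfl fun x _ => ?_
        rw [sq, Finset.sum_mul_sum, Finset.sum_mul]
        refine Finset.sum_congr rfl fun i _ => ?_
        rw [Finset.sum_mul]
        exact Finset.sum_congr rfl fun j _ => by ring
  have hw : ∑ j, u j ^ 2 / n = 1 := by
    rw [← Finset.sum_div, hs]; field_simp
  have := Real.pow_arith_mean_le_arith_mean_pow_of_even Finset.univ (fun j => u j ^ 2 / n) z
    (fun i _ => by positivity) hw hm
  calc ((∑ i, ∑ j, A i j) / n) ^ m = (∑ i, u i ^ 2 / n * z i) ^ m := by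
        rw [hAu, Finset.sum_div]; congr 1; exact Finset.sum_congr rfl fun i _ => by ring
    _ ≤ _ := this
    _ ≤ _ := by
      refine Finset.sum_le_sum fun i _ => ?_
      have h0 : u i ^ 2 / n ≤ 1 := by
        rw [← hw]
        exact Finset.single_le_sum (f := fun j => u j ^ 2 / (n:ℝ)) (fun j _ => by positivity) (Finset.mem_univ i)
      have := hm.pow_nonneg (z i)
      nlinarith

theorem holder {n : ℕ} (z : Fin n → ℝ) (k l : ℕ) (hk : 2 ≤ k) (hl : 2 ≤ l) (hkl : l ≤ 2*k)
    (θ : ℝ) (hθ : θ = (2*k-l)/(2*k-2)) :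
    ∑ i, |z i| ^ l ≤ (∑ i, z i ^ 2) ^ θ * (∑ i, z i ^ (2*k)) ^ (1-θ) := by
  have hk' : (2:ℝ) ≤ k := by exact_mod_cast hk
  have hl' : (2:ℝ) ≤ l := by exact_mod_cast hl
  have hkl' : (l:ℝ) ≤ 2*k := by exact_mod_cast hkl
  have hθ0 : 0 ≤ θ := by rw [hθ]; apply div_nonneg <;> linarith
  have hθ1 : θ ≤ 1 := by rw [hθ, div_le_one (by linarith)]; linarith
  by_cases hz : ∀ i, z i = 0
  · have : ∑ i, |z i| ^ l = 0 := Finset.sum_eq_zero fun i _ => by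
      rw [hz i]; simp; omega
    rw [this]
    have : 0 ≤ ∑ i, z i ^ (2*k) := Finset.sum_nonneg fun i _ => by rw [pow_mul]; positivity
    positivity
  push Not at hz
  obtain ⟨i0, hi0⟩ := hz
  have hpow : ∀ i, z i ^ (2*k) = |z i| ^ (2*k) := fun i => by
    rw [pow_mul, pow_mul, sq_abs]
  have hA : 0 < ∑ i, z i ^ 2 :=
    Finset.sum_pos' (fun i _ => by positivity) ⟨i0, Finset.mem_univ _, by positivity⟩
  have hB : 0 < ∑ i, z i ^ (2*k) :=
    Finset.sum_pos' (fun i _ => by rw [hpow]; positivity) ⟨i0, Finset.mem_univ _, by rw [hpow]; positivity⟩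
  set S := ∑ i, z i ^ 2 with hS
  set R := ∑ i, z i ^ (2*k) with hR
  have key : ∀ i, |z i| ^ l ≤ S ^ θ * R ^ (1-θ) * (θ * (z i ^ 2 / S) + (1-θ) * (z i ^ (2*k) / R)) := by
    intro i
    have h := Real.geom_mean_le_arith_mean2_weighted hθ0 (sub_nonneg.2 hθ1)
      (p₁ := z i ^ 2 / S) (p₂ := z i ^ (2*k) / R) (by positivity)
      (by rw [hpow]; positivity) (by ring)
    have hc : 0 < S ^ θ * R ^ (1-θ) := by positivity
    refine le_trans (le_of_eq ?_) (mul_le_mul_of_nonneg_left h hc.le)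
    rw [Real.div_rpow (by positivity) hA.le, Real.div_rpow (by rw [hpow]; positivity) hB.le]
    have h1 : (z i ^ 2) ^ θ * (z i ^ (2*k)) ^ (1-θ) = |z i| ^ l := by
      rcases eq_or_ne (z i) 0 with h0 | h0
      · rw [h0]
        have a1 : (0:ℝ) ^ 2 = 0 := by simp
        have a2 : (0:ℝ) ^ (2*k) = 0 := by simp; omega
        have a3 : |(0:ℝ)| ^ l = 0 := by simp; omega
        rw [a1, a2, a3]
        rcases eq_or_ne θ 0 with h | h
        · rw [h]; simp
        · rw [Real.zero_rpow h]; simp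
      · have hp : 0 < |z i| := abs_pos.2 h0
        rw [hpow, ← sq_abs, ← Real.rpow_natCast, ← Real.rpow_natCast, ← Real.rpow_mul hp.le,
          ← Real.rpow_mul hp.le, ← Real.rpow_add hp, ← Real.rpow_natCast]
        congr 1
        push_cast
        rw [hθ]
        have : (2*(k:ℝ)-2) ≠ 0 := by linarith
        have : (k:ℝ)-1 ≠ 0 := by linarith
        field_simp
        ring
    rw [← h1]
    have : S ^ θ ≠ 0 := by positivity
    have : R ^ (1-θ) ≠ 0 := by positivity
    field_simp
  calc _ ≤ ∑ i, S ^ θ * R ^ (1-θ) * (θ * (z i ^ 2 / S) + (1-θ) * (z i ^ (2*k) / R)) :=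
        Finset.sum_le_sum fun i _ => key i
    _ = _ := by
      rw [← Finset.mul_sum, Finset.sum_add_distrib, ← Finset.mul_sum, ← Finset.mul_sum,
        ← Finset.sum_div, ← Finset.sum_div, ← hS, ← hR]
      field_simp
      ring

theorem upper (k l : ℕ) (hk : 2 ≤ k) (hl : 2 ≤ l) (hkl : l ≤ 2*k)
    (H : SimpleGraph (Fin l))
    (hHam : ∃ σ : Equiv.Perm (Fin l),
      ∀ x y, (cycleGraph l).Adj x y → H.Adj (σ x) (σ y)) :
    (4*(k:ℝ)*((k:ℝ)-1)) / (2*(k:ℝ)*(l:ℝ) - 2*(k:ℝ) - (l:ℝ)) ∈ domSet (cycleGraph (2*k)) H := by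
  have hk' : (2:ℝ) ≤ k := by exact_mod_cast hk
  have hl' : (2:ℝ) ≤ l := by exact_mod_cast hl
  have hkl' : (l:ℝ) ≤ 2*k := by exact_mod_cast hkl
  have hD : 0 < 2*(k:ℝ)*(l:ℝ) - 2*(k:ℝ) - (l:ℝ) := by nlinarith
  have hN : 0 < 4*(k:ℝ)*((k:ℝ)-1) := by
    have : 0 < (k:ℝ) - 1 := by linarith
    positivity
  refine ⟨by positivity, fun n hn T => ?_⟩
  have hn' : (0:ℝ) < n := by exact_mod_cast hn
  -- H vs cycle
  have hHC : (Nat.card (H →g T) : ℝ) ≤ Nat.card (cycleGraph l →g T) := by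
    obtain ⟨σ, hσ⟩ := hHam
    have : Finite (cycleGraph l →g T) := Finite.of_injective (fun φ => (φ : Fin l → Fin n)) DFunLike.coe_injective
    have := Nat.card_le_card_of_injective
      (fun φ : H →g T => (φ.comp ⟨σ, fun {a b} h => hσ a b h⟩ : cycleGraph l →g T)) (by
        intro φ ψ h
        ext x
        have := congrArg (fun f : cycleGraph l →g T => f (σ.symm x)) h
        simpa using congrArg Fin.val this)
    exact_mod_cast this
  rw [hom_cycle T l hl] at hHC
  unfold homDensity
  rw [hom_cycle T (2*k) (by omega)]
  simp only [Fintype.card_fin]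
  obtain ⟨U, z, h1, h2, hA⟩ := spec (adjM T) (by
    ext x y; by_cases h : T.Adj x y <;> simp [adjM, h, T.adj_comm y x])
  have hs := sid hn (adjM T) U z hA h1 (2*k) (by simp)
  have hsum : ∑ i, ∑ j, adjM T i j = ∑ i, z i ^ 2 := by
    rw [← spec_pow _ U z h2 hA h1 2, sq, Matrix.trace]
    simp only [Matrix.diag_apply, Matrix.mul_apply]
    refine Finset.sum_congr rfl fun i _ => Finset.sum_congr rfl fun j _ => ?_
    simp [adjM, T.adj_comm j i]
  rw [hsum] at hs
  rw [spec_pow _ U z h2 hA h1] at hHC ⊢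
  set θ : ℝ := (2*k-l)/(2*k-2) with hθ
  have hθ0 : 0 ≤ θ := by rw [hθ]; apply div_nonneg <;> linarith
  have hθ1 : θ ≤ 1 := by rw [hθ, div_le_one (by linarith)]; linarith
  have hh := holder z k l hk hl hkl θ hθ
  have hle : ∑ i, z i ^ l ≤ ∑ i, |z i| ^ l :=
    Finset.sum_le_sum fun i _ => by rw [← abs_pow]; exact le_abs_self _
  set S := ∑ i, z i ^ 2 with hS
  set R := ∑ i, z i ^ (2*k) with hR
  have hS0 : 0 ≤ S := Finset.sum_nonneg fun i _ => by positivity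
  have hR0 : 0 ≤ R := Finset.sum_nonneg fun i _ => by rw [pow_mul]; positivity
  set r := R / (n:ℝ)^(2*k) with hr
  have hr0 : 0 ≤ r := by positivity
  have hs' : S / n^2 ≤ r ^ (1/(2*k:ℝ)) := by
    have : (S / (n:ℝ)^2) ^ (2*k) ≤ r := by
      rw [hr, le_div_iff₀ (by positivity), ← mul_pow]
      refine le_trans (le_of_eq ?_) hs
      congr 1
      field_simp
    have h3 := Real.rpow_le_rpow (by positivity) this (z := 1/(2*k:ℝ)) (by positivity)
    rw [← Real.rpow_natCast, ← Real.rpow_mul (by positivity)] at h3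
    refine le_trans (le_of_eq ?_) h3
    rw [show ((2*k:ℕ):ℝ) * (1/(2*k:ℝ)) = 1 by push_cast; field_simp, Real.rpow_one]
  have hfin : (Nat.card (H →g T) : ℝ) / (n:ℝ)^l ≤ r ^ ((2*(k:ℝ)*(l:ℝ) - 2*(k:ℝ) - (l:ℝ)) / (4*(k:ℝ)*((k:ℝ)-1))) := by
    have h4 : (n:ℝ)^l = ((n:ℝ)^2)^θ * ((n:ℝ)^(2*k))^(1-θ) := by
      rw [← Real.rpow_natCast, ← Real.rpow_natCast, ← Real.rpow_natCast, ← Real.rpow_mul hn'.le,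
          ← Real.rpow_mul hn'.le, ← Real.rpow_add hn']
      congr 1
      push_cast
      rw [hθ]
      have : (2*(k:ℝ)-2) ≠ 0 := by linarith
      have : (k:ℝ)-1 ≠ 0 := by linarith
      field_simp
      ring
    calc (Nat.card (H →g T) : ℝ) / (n:ℝ)^l ≤ (S ^ θ * R ^ (1-θ)) / (n:ℝ)^l := by
          gcongr; linarith
      _ = (S / n^2) ^ θ * r ^ (1-θ) := by
          rw [h4, hr, Real.div_rpow hS0 (by positivity), Real.div_rpow hR0 (by positivity)]
          field_simp
      _ ≤ (r ^ (1/(2*k:ℝ))) ^ θ * r ^ (1-θ) := by gcongr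
      _ = r ^ (1/(2*k:ℝ) * θ + (1-θ)) := by
          rw [← Real.rpow_mul hr0, Real.rpow_add_of_nonneg hr0 (by positivity) (by linarith)]
      _ = _ := by
          congr 1
          rw [hθ]
          have : (2*(k:ℝ)-2) ≠ 0 := by linarith
          have : (k:ℝ)-1 ≠ 0 := by linarith
          field_simp
          ring
  refine le_trans (Real.rpow_le_rpow (by positivity) hfin (by positivity)) (le_of_eq ?_)
  rw [← Real.rpow_mul hr0, div_mul_div_cancel₀ hN.ne', div_self hD.ne', Real.rpow_one]

theorem domSet_apply {α β V : Type*} [Fintype α] [Fintype β] [Fintype V] [Nonempty V]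
    (G : SimpleGraph α) (H : SimpleGraph β) (c : ℝ) (hc : c ∈ domSet G H) (T : SimpleGraph V) :
    homDensity H T ^ c ≤ homDensity G T := by
  have := hc.2 (Fintype.card V) Fintype.card_pos (T.overFin rfl)
  have e := T.overFinIso (n := Fintype.card V) rfl
  have key : ∀ {γ : Type _} [Fintype γ] (K : SimpleGraph γ),
      homDensity K (T.overFin (n := Fintype.card V) rfl) = homDensity K T := by
    intro γ _ K
    unfold homDensity
    rw [Fintype.card_fin]
    congr 2
    refine Nat.card_congr ⟨fun φ => e.symm.toHom.comp φ, fun φ => e.toHom.comp φ, ?_, ?_⟩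
    · intro φ; ext x; simp
    · intro φ; ext x; simp
  have key' : ∀ {γ : Type _} [Fintype γ] (K : SimpleGraph γ),
      homDensity K (T.overFin (n := Fintype.card V) rfl) = homDensity K T := by
    intro γ _ K
    unfold homDensity
    rw [Fintype.card_fin]
    congr 2
    refine Nat.card_congr ⟨fun φ => e.symm.toHom.comp φ, fun φ => e.toHom.comp φ, ?_, ?_⟩
    · intro φ; ext x; simp
    · intro φ; ext x; simp
  rwa [key, key'] at this

def coG (M q : ℕ) [NeZero q] : SimpleGraph (Fin M → Fin q) where
  Adj x y := x ≠ y ∧ ∃ i, x i = 0 ∧ y i = 0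
  symm := ⟨fun x y h => ⟨h.1.symm, h.2.imp fun i hi => ⟨hi.2, hi.1⟩⟩⟩
  loopless := ⟨fun x h => h.1 rfl⟩

noncomputable def coB (M q : ℕ) [NeZero q] : Matrix (Fin M → Fin q) (Fin M) ℝ :=
  fun x i => if x i = 0 then 1 else 0

theorem trace_mono {V : Type*} [Fintype V] [DecidableEq V] (A B : Matrix V V ℝ) (m : ℕ)
    (h0 : ∀ x y, 0 ≤ A x y) (h : ∀ x y, A x y ≤ B x y) :
    (A ^ (m+1)).trace ≤ (B ^ (m+1)).trace := by
  rw [← cycle_sum, ← cycle_sum]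
  exact Finset.sum_le_sum fun f _ => Finset.prod_le_prod (fun i _ => h0 _ _) fun i _ => h _ _

theorem trace_swap {V W : Type*} [Fintype V] [DecidableEq V] [Fintype W] [DecidableEq W]
    (B : Matrix V W ℝ) (C : Matrix W V ℝ) (m : ℕ) :
    ((B * C) ^ (m+1)).trace = ((C * B) ^ (m+1)).trace := by
  have : ∀ m : ℕ, (B * C) ^ (m+1) = B * ((C * B) ^ m * C) := by
    intro m
    induction m with
    | zero => simp
    | succ m ih =>
      rw [pow_succ, ih, pow_succ (C * B) m]
      simp only [Matrix.mul_assoc]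
  rw [this, Matrix.trace_mul_comm, Matrix.mul_assoc, pow_succ]

theorem trace_IJ (M : ℕ) (x y : ℝ) (hy : 0 ≤ y) (m : ℕ) :
    ((y • (1 : Matrix (Fin M) (Fin M) ℝ) + x • Matrix.of (fun _ _ => 1)) ^ m).trace
      ≤ M * y ^ m + (y + M * x) ^ m := by
  set J : Matrix (Fin M) (Fin M) ℝ := Matrix.of (fun _ _ => 1) with hJ
  have hJJ : J * J = (M:ℝ) • J := by
    ext i j; simp [hJ, Matrix.mul_apply]
  have : ∃ b : ℝ, (y • (1 : Matrix (Fin M) (Fin M) ℝ) + x • J) ^ m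
      = y ^ m • (1 : Matrix (Fin M) (Fin M) ℝ) + b • J ∧ M * b = (y + M * x) ^ m - y ^ m := by
    induction m with
    | zero => exact ⟨0, by simp, by simp⟩
    | succ m ih =>
      obtain ⟨b, h1, h2⟩ := ih
      refine ⟨y ^ m * x + b * y + b * x * M, ?_, ?_⟩
      · rw [pow_succ, h1]
        simp only [add_mul, mul_add, Matrix.smul_mul, Matrix.mul_smul, Matrix.one_mul,
          Matrix.mul_one, hJJ, smul_smul, add_smul]
        rw [pow_succ]
        module
      · have : (M:ℝ) * (y ^ m * x + b * y + b * x * M) = M * y^m * x + (M * b) * (y + M * x) := by ring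
        rw [this, h2]; ring
  obtain ⟨b, h1, h2⟩ := this
  rw [h1]
  have : Matrix.trace J = M := by simp [hJ, Matrix.trace]
  rw [Matrix.trace_add, Matrix.trace_smul, Matrix.trace_smul, this, Matrix.trace_one, Fintype.card_fin]
  simp only [smul_eq_mul]
  have := pow_nonneg hy m
  linarith

theorem gram (M q : ℕ) [NeZero q] (i j : Fin M) :
    ((coB M q).transpose * coB M q) i j = (q:ℝ)^M * (if i = j then (1/q:ℝ) else (1/q:ℝ)^2) := by
  have hq : (q:ℝ) ≠ 0 := by exact_mod_cast NeZero.ne q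
  rw [Matrix.mul_apply]
  simp only [Matrix.transpose_apply, coB]
  have h1 : ∀ x : Fin M → Fin q, ((if x i = 0 then (1:ℝ) else 0) * (if x j = 0 then 1 else 0))
      = ∏ m, (if m = i ∨ m = j then (if x m = 0 then (1:ℝ) else 0) else 1) := by
    intro x
    have e0 : ((if x i = 0 then (1:ℝ) else 0) * (if x j = 0 then 1 else 0))
        = if x i = 0 ∧ x j = 0 then 1 else 0 := by
      by_cases h : x i = 0 <;> simp [h]
    rw [e0]
    by_cases h : x i = 0 ∧ x j = 0
    · rw [if_pos h, Finset.prod_eq_one]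
      rintro m -
      split_ifs with h1 h2
      · rfl
      · rcases h1 with rfl | rfl <;> tauto
      · rfl
    · rw [if_neg h]
      by_cases hi : x i = 0
      · have hj : x j ≠ 0 := fun hj => h ⟨hi, hj⟩
        rw [Finset.prod_eq_zero (Finset.mem_univ j)]; simp [hj]
      · rw [Finset.prod_eq_zero (Finset.mem_univ i)]; simp [hi]
  simp only [h1]
  have h2 := Finset.prod_univ_sum (fun _ : Fin M => (Finset.univ : Finset (Fin q)))
    (fun m t => (if m = i ∨ m = j then (if t = 0 then (1:ℝ) else 0) else 1))
  rw [Fintype.piFinset_univ] at h2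
  rw [← h2]
  have h3 : ∀ m : Fin M, (∑ t : Fin q, (if m = i ∨ m = j then (if t = 0 then (1:ℝ) else 0) else 1))
      = q * (if m ∈ ({i, j} : Finset (Fin M)) then (1/q:ℝ) else 1) := by
    intro m
    by_cases h : m = i ∨ m = j
    · simp [h, hq]
    · simp [h]
  simp only [h3]
  rw [Finset.prod_mul_distrib, Finset.prod_const, Finset.card_univ, Fintype.card_fin,
    Finset.prod_ite_mem, Finset.univ_inter, Finset.prod_const]
  congr 1
  split_ifs with h
  · subst h; simp
  · rw [Finset.card_pair h]

theorem cycle_upper (M q m : ℕ) [NeZero q] (hm : 2 ≤ m) :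
    homDensity (cycleGraph m) (coG M q) ≤
      M * (1/q:ℝ)^m + (1/q + M * (1/q:ℝ)^2)^m := by
  have hq : (0:ℝ) < q := by exact_mod_cast NeZero.pos q
  have hq1 : (1:ℝ) ≤ q := by exact_mod_cast NeZero.pos q
  unfold homDensity
  rw [hom_cycle _ m hm]
  simp only [Fintype.card_pi, Fintype.card_fin, Finset.prod_const, Finset.card_univ]
  push_cast
  rw [div_le_iff₀ (by positivity)]
  obtain ⟨n, rfl⟩ := Nat.exists_eq_add_of_le' hm
  have h1 : ((adjM (coG M q)) ^ (n+1+1)).trace ≤ ((coB M q * (coB M q).transpose)^(n+1+1)).trace := by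
    refine trace_mono _ _ _ (fun x y => ?_) fun x y => ?_
    · unfold adjM; split_ifs <;> norm_num
    · rw [Matrix.mul_apply]
      have hnn : ∀ i ∈ Finset.univ, 0 ≤ coB M q x i * (coB M q).transpose i y := by
        intro i _
        simp only [coB, Matrix.transpose_apply]
        split_ifs <;> norm_num
      unfold adjM
      split_ifs with h
      · obtain ⟨-, i, hi, hj⟩ := h
        refine le_trans ?_ (Finset.single_le_sum hnn (Finset.mem_univ i))
        simp [coB, hi, hj]
      · exact Finset.sum_nonneg hnn
  refine h1.trans ?_
  rw [trace_swap]
  have h2 : (coB M q).transpose * coB M q = ((q:ℝ)^M) • ((1/q - (1/q)^2 : ℝ) • (1 : Matrix (Fin M) (Fin M) ℝ)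
      + ((1/q)^2 : ℝ) • Matrix.of (fun _ _ => 1)) := by
    ext i j
    rw [gram]
    by_cases h : i = j
    · simp [h]
    · simp [h, Matrix.one_apply]
  rw [h2, smul_pow, Matrix.trace_smul, smul_eq_mul, mul_comm]
  refine mul_le_mul_of_nonneg_right ?_ (by positivity)
  have ha : (1/q:ℝ)^2 ≤ 1/q := by
    have : (1/q:ℝ) ≤ 1 := by rw [div_le_one hq]; exact hq1
    have : (0:ℝ) ≤ 1/q := by positivity
    nlinarith
  refine (trace_IJ M _ _ (by linarith) _).trans ?_
  have h3 : (1/q:ℝ) - (1/q)^2 ≤ 1/q := by have : (0:ℝ) ≤ (1/q)^2 := by positivity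
                                          linarith
  have h4 : 0 ≤ (1/q:ℝ) - (1/q)^2 := by linarith
  gcongr

theorem H_lower (M q l : ℕ) [NeZero q] (H : SimpleGraph (Fin l)) (hM : (M:ℝ) * (1/q:ℝ)^l ≤ 1)
    (hl : 1 ≤ l) (hn : l ≤ q^M) :
    (M:ℝ) * (1/q:ℝ)^l / 2 - l^2 / (q:ℝ)^M ≤ homDensity H (coG M q) := by
  classical
  have hq : (0:ℝ) < q := by exact_mod_cast NeZero.pos q
  have hq1 : (1:ℝ) ≤ q := by exact_mod_cast NeZero.pos q
  set n : ℕ := q^M with hnn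
  have hn0 : (0:ℝ) < n := by rw [hnn]; push_cast; positivity
  set X := Fin M → Fin q
  have hX : Fintype.card X = n := by simp [X, hnn]
  -- bad sets
  let P : Finset (Fin l → X) := Finset.univ.filter fun f => ∃ i, ∀ a, f a i = 0
  let I : Finset (Fin l → X) := Finset.univ.filter fun f => Function.Injective f
  have hhom : (P ∩ I).card ≤ Nat.card (H →g coG M q) := by
    have : Finite (H →g coG M q) :=
      Finite.of_injective (fun φ => (φ : Fin l → X)) DFunLike.coe_injective
    rw [← Nat.card_eq_finsetCard]
    refine Nat.card_le_card_of_injective (fun f : {f // f ∈ P ∩ I} => (⟨f.1, ?_⟩ : H →g coG M q)) ?_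
    · intro a b hab
      have hf := Finset.mem_inter.1 f.2
      obtain ⟨i, hi⟩ := (Finset.mem_filter.1 hf.1).2
      exact ⟨fun h => hab.ne ((Finset.mem_filter.1 hf.2).2 h), i, hi a, hi b⟩
    · intro f g h
      exact Subtype.ext (congrArg (fun φ : H →g coG M q => (φ : Fin l → X)) h)
  have hP : (P.card : ℝ) = (n:ℝ)^l - ((q:ℝ)^l - 1)^M := by
    have h1 : Pᶜ.card = (q^l - 1)^M := by
      have e : {f : Fin l → X // f ∈ Pᶜ} ≃ (Fin M → {g : Fin l → Fin q // g ≠ fun _ => 0}) :=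
        { toFun := fun f i => ⟨fun a => f.1 a i, fun h => by
            have := f.2
            rw [Finset.mem_compl] at this
            exact this (Finset.mem_filter.2 ⟨Finset.mem_univ _, i, fun a => congrFun h a⟩)⟩
          invFun := fun g => ⟨fun a i => (g i).1 a, by
            rw [Finset.mem_compl]
            intro h
            obtain ⟨i, hi⟩ := (Finset.mem_filter.1 h).2
            exact (g i).2 (funext hi)⟩
          left_inv := fun f => rfl
          right_inv := fun g => rfl }
      rw [← Nat.card_eq_finsetCard, Nat.card_congr e, Nat.card_eq_fintype_card, Fintype.card_pi]
      simp [Fintype.card_subtype_compl]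
    have h2 := Finset.card_add_card_compl P
    have h3 : Fintype.card (Fin l → X) = n^l := by
      rw [Fintype.card_pi]; simp [X, hnn]
    rw [h1, h3] at h2
    have h4 : (P.card : ℝ) + ((q^l - 1 : ℕ) : ℝ)^M = (n:ℝ)^l := by exact_mod_cast h2
    rw [Nat.cast_sub (Nat.one_le_pow _ _ (NeZero.pos q))] at h4
    push_cast at h4 ⊢
    linarith
  have hI : (n:ℝ)^l - l^2 / n * (n:ℝ)^l ≤ I.card := by
    have h1 : I.card = n.descFactorial l := by
      rw [← hX]
      conv_rhs => rw [← Fintype.card_fin l]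
      rw [← Fintype.card_embedding_eq, ← Fintype.card_subtype]
      exact Fintype.card_congr (Equiv.subtypeInjectiveEquivEmbedding _ _)
    rw [h1]
    have h2 := Nat.pow_sub_le_descFactorial n l
    have h3 : ((n:ℝ) - l)^l ≤ (n.descFactorial l : ℝ) := by
      refine le_trans ?_ (Nat.cast_le.2 h2)
      rw [Nat.cast_pow (n + 1 - l), Nat.cast_sub (by omega)]
      have : (l:ℝ) ≤ n := by exact_mod_cast hn
      rw [Nat.cast_add, Nat.cast_one]
      refine pow_le_pow_left₀ (by linarith) (by linarith) _
    refine le_trans ?_ h3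
    have hln : (l:ℝ)/n ≤ 1 := by rw [div_le_one hn0]; exact_mod_cast hn
    have h4 := one_add_mul_le_pow (a := -((l:ℝ)/n)) (by linarith) l
    have h5 : ((n:ℝ) - l)^l = (1 + -((l:ℝ)/n))^l * (n:ℝ)^l := by
      rw [← mul_pow]; congr 1; field_simp; ring
    rw [h5]
    have := mul_le_mul_of_nonneg_right h4 (by positivity : (0:ℝ) ≤ (n:ℝ)^l)
    refine le_trans (le_of_eq ?_) this
    field_simp
    ring
  have hPI : (P.card : ℝ) + I.card ≤ (P ∩ I).card + (n:ℝ)^l := by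
    have h1 := Finset.card_union_add_card_inter P I
    have h2 : (P ∪ I).card ≤ n^l := by
      refine (Finset.card_le_univ _).trans (le_of_eq ?_)
      rw [Fintype.card_pi]; simp [X, hnn]
    have : P.card + I.card ≤ (P ∩ I).card + n^l := by omega
    exact_mod_cast this
  have hP2 : (M:ℝ) * (1/q:ℝ)^l / 2 * (n:ℝ)^l ≤ P.card := by
    rw [hP]
    set a := (1/q:ℝ)^l with ha
    have ha0 : 0 ≤ a := by positivity
    have ha1 : a ≤ 1 := by
      rw [ha]; exact pow_le_one₀ (by positivity) (by rw [div_le_one hq]; exact hq1)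
    have h1 : ((q:ℝ)^l - 1)^M = (1 - a)^M * (n:ℝ)^l := by
      rw [hnn, Nat.cast_pow, ← pow_mul, mul_comm M l, pow_mul, ← mul_pow]
      congr 1
      rw [ha, sub_mul, ← mul_pow]
      field_simp
      simp
    have h2 : (1-a)^M * (1 + M * a) ≤ 1 := by
      calc (1-a)^M * (1 + M * a) ≤ (1-a)^M * (1+a)^M := by
            apply mul_le_mul_of_nonneg_left _ (pow_nonneg (by linarith) _)
            exact one_add_mul_le_pow (by linarith) M
        _ = (1 - a^2)^M := by rw [← mul_pow]; congr 1; ring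
        _ ≤ 1 := pow_le_one₀ (by nlinarith) (by nlinarith)
    have h3 : (M:ℝ) * a / 2 ≤ 1 - (1-a)^M := by
      have hMa : 0 ≤ M * a := by positivity
      have : (1-a)^M ≤ 1 - M * a / 2 := by
        have h6 : 1 ≤ (1 - M * a / 2) * (1 + M * a) := by nlinarith
        exact le_of_mul_le_mul_right (h2.trans h6) (by linarith)
      linarith
    rw [h1]
    have := mul_le_mul_of_nonneg_right h3 (by positivity : (0:ℝ) ≤ (n:ℝ)^l)
    linarith
  unfold homDensity
  have hc : (Fintype.card (Fin M → Fin q)) = n := hX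
  rw [hc, Fintype.card_fin, le_div_iff₀ (by positivity)]
  have : ((P ∩ I).card : ℝ) ≤ Nat.card (H →g coG M q) := by exact_mod_cast hhom
  have e : (q:ℝ)^M = n := by rw [hnn]; push_cast; rfl
  rw [e, sub_mul]
  linarith

theorem lower (k l : ℕ) (hk : 2 ≤ k) (hl : 2 ≤ l) (H : SimpleGraph (Fin l))
    (c : ℝ) (hc : c ∈ domSet (cycleGraph (2*k)) H) :
    (4*(k:ℝ)*((k:ℝ)-1)) / (2*(k:ℝ)*(l:ℝ) - 2*(k:ℝ) - (l:ℝ)) ≤ c := by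
  have hk' : (2:ℝ) ≤ k := by exact_mod_cast hk
  have hl' : (2:ℝ) ≤ l := by exact_mod_cast hl
  have hD : 0 < 2*(k:ℝ)*(l:ℝ) - 2*(k:ℝ) - (l:ℝ) := by nlinarith
  set D := 2*(k:ℝ)*(l:ℝ) - 2*(k:ℝ) - (l:ℝ) with hDd
  set N := 4*(k:ℝ)*((k:ℝ)-1) with hN
  have hc0 := hc.1
  -- main estimate
  have main : ∀ d : ℕ, 4 * l ≤ d → (d:ℝ) ^ (N - D * c) ≤ (1 + 2^(2*k)) * 4 ^ c := by
    intro d hd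
    have hd1 : 1 ≤ d := by omega
    have hd0 : (0:ℝ) < d := by exact_mod_cast hd1
    have hd1' : (1:ℝ) ≤ d := by exact_mod_cast hd1
    set M := d^(2*k) with hM
    set q := d^(2*k-1) with hq
    have : NeZero q := ⟨by positivity⟩
    have hqR : (1/q:ℝ) = (d:ℝ) ^ (-(2*k-1:ℝ)) := by
      rw [hq, Real.rpow_neg hd0.le, one_div]
      congr 1
      rw [Nat.cast_pow, ← Real.rpow_natCast, Nat.cast_sub (by omega)]
      push_cast; rfl
    have hMR : (M:ℝ) = (d:ℝ) ^ (2*k:ℝ) := by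
      rw [hM, Nat.cast_pow, ← Real.rpow_natCast]; push_cast; rfl
    have hpw : ∀ m : ℕ, (M:ℝ) * (1/q:ℝ)^m = (d:ℝ)^(2*k - (2*k-1)*m:ℝ) := by
      intro m
      rw [hMR, hqR, ← Real.rpow_natCast, ← Real.rpow_mul hd0.le, ← Real.rpow_add hd0]
      congr 1; ring
    have h1 := cycle_upper M q (2*k) (by omega)
    have h1' : homDensity (cycleGraph (2*k)) (coG M q) ≤ (1 + 2^(2*k)) * (d:ℝ)^(-N) := by
      refine h1.trans ?_
      have e1 : (M:ℝ) * (1/q:ℝ)^(2*k) = (d:ℝ)^(-N) := by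
        rw [hpw]; congr 1; push_cast; rw [hN]; ring
      have e2 : (M:ℝ) * (1/q:ℝ) = d := by
        have := hpw 1
        rw [pow_one] at this
        rw [this]
        conv_rhs => rw [← Real.rpow_one (d:ℝ)]
        congr 1; push_cast; ring
      have e3 : (1/q + M * (1/q:ℝ)^2) ≤ 2 * (d * (1/q:ℝ)) := by
        have : (M:ℝ) * (1/q:ℝ)^2 = d * (1/q:ℝ) := by rw [sq, ← mul_assoc, e2]
        rw [this]
        have : (0:ℝ) ≤ 1/q := by positivity
        nlinarith
      have e4 : (1/q + M * (1/q:ℝ)^2)^(2*k) ≤ 2^(2*k) * (d:ℝ)^(-N) := by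
        refine (pow_le_pow_left₀ (by positivity) e3 _).trans (le_of_eq ?_)
        rw [mul_pow, mul_pow, ← e1, hM]; push_cast; rfl
      rw [e1]; linarith
    have hMl : (M:ℝ) * (1/q:ℝ)^l = (d:ℝ)^(-D) := by
      rw [hpw]; congr 1; rw [hDd]; ring
    have hbig : 4 * l^2 * (d:ℝ)^D ≤ (q:ℝ)^M := by
      have a1 : (4 * l^2 : ℝ) ≤ (d:ℝ)^(2:ℝ) := by
        have : (4*l:ℝ) ≤ d := by exact_mod_cast hd
        rw [Real.rpow_two]; nlinarith
      have a2 : (q:ℝ)^M = (d:ℝ)^((2*k-1)*M:ℝ) := by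
        rw [hq, Nat.cast_pow, ← pow_mul, ← Real.rpow_natCast]
        congr 1
        rw [Nat.cast_mul, Nat.cast_sub (by omega)]
        push_cast; rfl
      rw [a2]
      calc 4 * l^2 * (d:ℝ)^D ≤ (d:ℝ)^(2:ℝ) * (d:ℝ)^D := by gcongr
        _ = (d:ℝ)^(2 + D) := by rw [Real.rpow_add hd0]
        _ ≤ _ := by
          apply Real.rpow_le_rpow_of_exponent_le hd1'
          have b1 : d ≤ M := by
            rw [hM]; exact Nat.le_self_pow (by omega) d
          have b2 : (4*l:ℝ) ≤ M := by exact_mod_cast hd.trans b1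
          rw [hDd]
          nlinarith
    have hqM : (0:ℝ) < (q:ℝ)^M := by
      have := NeZero.pos q
      positivity
    have hdD : (1:ℝ) ≤ (d:ℝ)^D := Real.one_le_rpow hd1' hD.le
    have h2 := H_lower M q l H (by
      rw [hMl, Real.rpow_neg hd0.le]; exact inv_le_one_of_one_le₀ hdD) (by omega) (by
        have : (l:ℝ) ≤ (q:ℝ)^M := by nlinarith
        exact_mod_cast this)
    have h2' : (d:ℝ)^(-D) / 4 ≤ homDensity H (coG M q) := by
      refine le_trans ?_ h2
      rw [hMl]
      have : (l:ℝ)^2 / (q:ℝ)^M ≤ (d:ℝ)^(-D) / 4 := by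
        rw [Real.rpow_neg hd0.le, div_le_iff₀ hqM]
        field_simp
        linarith
      linarith
    have h3 := domSet_apply _ _ c hc (coG M q)
    have h4 := (Real.rpow_le_rpow (by positivity) h2' hc0).trans (h3.trans h1')
    rw [Real.div_rpow (by positivity) (by norm_num), ← Real.rpow_mul hd0.le,
      div_le_iff₀ (by positivity)] at h4
    rw [show N - D * c = N + -D * c by ring, Real.rpow_add hd0]
    calc (d:ℝ)^N * (d:ℝ)^(-D*c) ≤ (d:ℝ)^N * ((1 + 2^(2*k)) * (d:ℝ)^(-N) * 4^c) := by gcongr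
      _ = ((d:ℝ)^N * (d:ℝ)^(-N)) * ((1 + 2^(2*k)) * 4^c) := by ring
      _ = _ := by rw [← Real.rpow_add hd0]; simp
  rw [div_le_iff₀ hD]
  by_contra hcon
  push Not at hcon
  have hpos : 0 < N - D * c := by linarith
  have ht := (tendsto_rpow_atTop hpos).comp (tendsto_natCast_atTop_atTop (R := ℝ))
  obtain ⟨d, hd1, hd2⟩ := ((ht.eventually_gt_atTop ((1 + 2^(2*k)) * 4 ^ c)).and
    (Filter.eventually_ge_atTop (4*l))).exists
  exact absurd (main d hd2) (not_le.2 hd1)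

theorem stmt_8 (k l : ℕ) (hk : 2 ≤ k) (hl : 2 ≤ l) (hkl : l ≤ 2*k)
    (H : SimpleGraph (Fin l))
    (hHam : ∃ σ : Equiv.Perm (Fin l),
      ∀ x y, (cycleGraph l).Adj x y → H.Adj (σ x) (σ y)) :
    domExp (cycleGraph (2*k)) H =
      (4*(k:ℝ)*((k:ℝ)-1)) / (2*(k:ℝ)*(l:ℝ) - 2*(k:ℝ) - (l:ℝ)) := by

  have h1 := upper k l hk hl hkl H hHam
  exact le_antisymm (csInf_le ⟨0, fun c hc => hc.1⟩ h1)
    (le_csInf ⟨_, h1⟩ fun c hc => lower k l hk hl H c hc)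
end

section
/- Let k > ℓ ≥ 1 be integers. Then C(C_{2k+1}, C_{2ℓ+1}) ≥ (4k²−1)/(4kℓ−1). -/
open SimpleGraph

open Finset in
theorem four_cycle {V : Type*} [Fintype V] (f : V → V → ℝ) :
    (∑ x, ∑ y, f x y) ^ 4 ≤ (Fintype.card V : ℝ) ^ 4 *
      ∑ x0, ∑ x1, f x0 x1 * ∑ x2, f x2 x1 * ∑ x3, f x2 x3 * f x0 x3 := by
  classical
  have h1 : (∑ x, ∑ y, f x y) ^ 2 ≤ (Fintype.card V : ℝ) * ∑ y, (∑ x, f x y) ^ 2 := by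
    rw [Finset.sum_comm]
    simpa using sq_sum_le_card_mul_sum_sq (s := (univ : Finset V)) (f := fun y => ∑ x, f x y)
  have h2 : ∑ y, (∑ x, f x y) ^ 2 = ∑ p : V × V, ∑ y, f p.1 y * f p.2 y := by
    rw [Finset.sum_comm]
    refine Finset.sum_congr rfl fun y _ => ?_
    rw [sq, Finset.sum_mul_sum, Fintype.sum_prod_type]
  have h3 : (∑ p : V × V, ∑ y, f p.1 y * f p.2 y) ^ 2 ≤
      (Fintype.card V : ℝ) ^ 2 * ∑ p : V × V, (∑ y, f p.1 y * f p.2 y) ^ 2 := by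
    have := sq_sum_le_card_mul_sum_sq (s := (univ : Finset (V × V)))
      (f := fun p => ∑ y, f p.1 y * f p.2 y)
    simpa [sq] using this
  have h4 : ∑ p : V × V, (∑ y, f p.1 y * f p.2 y) ^ 2 =
      ∑ x0, ∑ x1, f x0 x1 * ∑ x2, f x2 x1 * ∑ x3, f x2 x3 * f x0 x3 := by
    rw [Fintype.sum_prod_type]
    refine Finset.sum_congr rfl fun x0 _ => ?_
    simp only [Finset.mul_sum]
    rw [Finset.sum_comm]
    refine Finset.sum_congr rfl fun x2 _ => ?_
    rw [sq, Finset.sum_mul_sum]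
    refine Finset.sum_congr rfl fun x1 _ => Finset.sum_congr rfl fun x3 _ => ?_
    ring
  rw [← h4]
  rw [h2] at h1
  have hn : (0:ℝ) ≤ Fintype.card V := by positivity
  calc (∑ x, ∑ y, f x y) ^ 4 = ((∑ x, ∑ y, f x y) ^ 2) ^ 2 := by ring
    _ ≤ ((Fintype.card V : ℝ) * ∑ p : V × V, ∑ y, f p.1 y * f p.2 y) ^ 2 := by
        gcongr
    _ = (Fintype.card V : ℝ) ^ 2 * (∑ p : V × V, ∑ y, f p.1 y * f p.2 y) ^ 2 := by ring
    _ ≤ (Fintype.card V : ℝ) ^ 2 * ((Fintype.card V : ℝ) ^ 2 *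
        ∑ p : V × V, (∑ y, f p.1 y * f p.2 y) ^ 2) := by gcongr
    _ = _ := by ring

theorem pow_entry {V : Type*} [Fintype V] [DecidableEq V] (A : Matrix V V ℝ) (N : ℕ) (x y : V) :
    (A ^ (N + 1)) x y = ∑ g : Fin N → V, ∏ i : Fin (N + 1),
      A (Fin.cons (α := fun _ => V) x g i) (Fin.snoc (α := fun _ => V) g y i) := by
  induction N generalizing x with
  | zero => simp [Fin.snoc]
  | succ N ih =>
    rw [pow_succ', Matrix.mul_apply, ← (Fin.consEquiv (fun _ => V)).sum_comp,
      Fintype.sum_prod_type]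
    refine Finset.sum_congr rfl fun z _ => ?_
    rw [ih, Finset.mul_sum]
    refine Finset.sum_congr rfl fun g _ => ?_
    rw [Fin.prod_univ_succ (n := N + 1)]
    simp [Fin.consEquiv, ← Fin.cons_snoc_eq_snoc_cons]

theorem trace_pow_cyc {V : Type*} [Fintype V] [DecidableEq V] (A : Matrix V V ℝ) (N : ℕ) :
    (A ^ (N + 1)).trace = ∑ h : Fin (N + 1) → V, ∏ i, A (h i) (h (i + 1)) := by
  rw [Matrix.trace, ← (Fin.consEquiv (fun _ => V)).sum_comp, Fintype.sum_prod_type]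
  refine Finset.sum_congr rfl fun x _ => ?_
  rw [Matrix.diag_apply, pow_entry]
  refine Finset.sum_congr rfl fun g _ => ?_
  refine Finset.prod_congr rfl fun i _ => ?_
  simp only [Fin.consEquiv, Equiv.coe_fn_mk]
  congr 1
  induction i using Fin.lastCases with
  | last => simp
  | cast i => simp 

theorem cyc_hom_iff {V : Type*} (T : SimpleGraph V) (N : ℕ) (hN : 1 ≤ N) (h : Fin (N + 1) → V) :
    (∀ a b, (cycleGraph (N + 1)).Adj a b → T.Adj (h a) (h b)) ↔ ∀ i, T.Adj (h i) (h (i + 1)) := by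
  obtain ⟨N, rfl⟩ : ∃ M, N = M + 1 := ⟨N - 1, by omega⟩
  constructor
  · intro H i
    apply H
    rw [SimpleGraph.cycleGraph_adj]
    right; simp
  · intro H a b hab
    rw [SimpleGraph.cycleGraph_adj] at hab
    rcases hab with hab | hab
    · have : a = b + 1 := by rw [← hab]; abel
      rw [this]; exact (H b).symm
    · have : b = a + 1 := by rw [← hab]; abel
      rw [this]; exact H a

def cycHomEquiv {V : Type*} (T : SimpleGraph V) (N : ℕ) (hN : 1 ≤ N) :
    (cycleGraph (N + 1) →g T) ≃ {h : Fin (N + 1) → V // ∀ i, T.Adj (h i) (h (i + 1))} where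
  toFun f := ⟨f, (cyc_hom_iff T N hN f).1 fun _ _ hab => f.map_rel hab⟩
  invFun h := ⟨h.1, fun {a b} hab => (cyc_hom_iff T N hN h.1).2 h.2 a b hab⟩
  left_inv _ := rfl
  right_inv _ := rfl

open Classical in
theorem card_hom_eq_trace {V : Type*} [Fintype V] (T : SimpleGraph V) (N : ℕ) (hN : 1 ≤ N) :
    (Nat.card (cycleGraph (N + 1) →g T) : ℝ) = ((T.adjMatrix ℝ) ^ (N + 1)).trace := by
  rw [trace_pow_cyc, Nat.card_congr (cycHomEquiv T N hN), Nat.card_eq_fintype_card,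
    Fintype.card_subtype, Finset.card_filter]
  push_cast
  refine Finset.sum_congr rfl fun h _ => ?_
  simp only [SimpleGraph.adjMatrix_apply]
  rw [Finset.prod_ite_zero]
  simp

open Classical in
theorem pow_entry_bound {V : Type*} [Fintype V] (T : SimpleGraph V) (N : ℕ) (x y : V) :
    0 ≤ ((T.adjMatrix ℝ) ^ (N + 1)) x y ∧
      ((T.adjMatrix ℝ) ^ (N + 1)) x y ≤ (Fintype.card V : ℝ) ^ N := by
  induction N generalizing x with
  | zero => simp only [zero_add, pow_one, SimpleGraph.adjMatrix_apply, pow_zero]; split_ifs <;> simp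
  | succ N ih =>
    rw [pow_succ', Matrix.mul_apply]
    constructor
    · refine Finset.sum_nonneg fun z _ => mul_nonneg ?_ (ih z).1
      rw [SimpleGraph.adjMatrix_apply]; split_ifs <;> simp
    · calc _ ≤ ∑ z : V, (Fintype.card V : ℝ) ^ N := by
            refine Finset.sum_le_sum fun z _ => ?_
            refine le_trans ?_ (ih z).2
            rw [SimpleGraph.adjMatrix_apply]; split_ifs
            · simp
            · simpa using (ih z).1
        _ = _ := by simp; ring

open Classical in
theorem trace_step {V : Type*} [Fintype V] (T : SimpleGraph V) (l : ℕ) (hl : 1 ≤ l) :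
    (((T.adjMatrix ℝ) ^ (2 * l + 1)).trace) ^ 4 ≤ (Fintype.card V : ℝ) ^ 4 *
      (((Fintype.card V : ℝ) ^ (2 * l - 1)) ^ 3 * ((T.adjMatrix ℝ) ^ (2 * l + 3)).trace) := by
  set A := T.adjMatrix ℝ with hA
  set K := (Fintype.card V : ℝ) ^ (2 * l - 1) with hK
  have hK0 : 0 ≤ K := by positivity
  have hA0 : ∀ x y, 0 ≤ A x y := fun x y => by
    rw [hA, SimpleGraph.adjMatrix_apply]; split_ifs <;> simp
  have hA1 : ∀ x y, A x y ≤ 1 := fun x y => by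
    rw [hA, SimpleGraph.adjMatrix_apply]; split_ifs <;> simp
  have hAs : ∀ x y, A x y = A y x := fun x y => by
    simp [hA, SimpleGraph.adjMatrix_apply, T.adj_comm]
  have hM : ∀ x y, 0 ≤ (A ^ (2 * l)) x y ∧ (A ^ (2 * l)) x y ≤ K := fun x y => by
    have := pow_entry_bound T (2 * l - 1) x y
    rwa [show 2 * l - 1 + 1 = 2 * l by omega] at this
  have h4 := four_cycle (fun x y => (A ^ (2 * l)) x y * A x y)
  have hS : (A ^ (2 * l + 1)).trace = ∑ x, ∑ y, (A ^ (2 * l)) x y * A x y := by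
    rw [pow_succ, Matrix.trace]
    refine Finset.sum_congr rfl fun x _ => ?_
    rw [Matrix.diag_apply, Matrix.mul_apply]
    exact Finset.sum_congr rfl fun y _ => by rw [hAs x y]
  have hf0 : ∀ x y, 0 ≤ (A ^ (2 * l)) x y * A x y := fun x y => mul_nonneg (hM x y).1 (hA0 x y)
  have hfK : ∀ x y, (A ^ (2 * l)) x y * A x y ≤ K * A x y := fun x y =>
    mul_le_mul_of_nonneg_right (hM x y).2 (hA0 x y)
  have hfM : ∀ x y, (A ^ (2 * l)) x y * A x y ≤ (A ^ (2 * l)) x y := fun x y =>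
    mul_le_of_le_one_right (hM x y).1 (hA1 x y)
  have hS3 : K ^ 3 * (A ^ (2 * l + 3)).trace = ∑ x0, ∑ x1, (A ^ (2 * l)) x0 x1 *
      ∑ x2, (K * A x2 x1) * ∑ x3, (K * A x2 x3) * (K * A x0 x3) := by
    have hp : A ^ (2 * l + 3) = A ^ (2 * l) * (A * (A * A)) := by
      rw [pow_add, pow_succ' A 2, sq]
    rw [hp, Matrix.trace, Finset.mul_sum]
    refine Finset.sum_congr rfl fun x0 _ => ?_
    simp only [Matrix.diag_apply, Matrix.mul_apply, Finset.mul_sum]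
    refine Finset.sum_congr rfl fun x1 _ => ?_
    refine Finset.sum_congr rfl fun x2 _ => ?_
    refine Finset.sum_congr rfl fun x3 _ => ?_
    rw [hAs x2 x1, hAs x0 x3]; ring
  rw [hS, hS3]
  refine h4.trans ?_
  have hKA : ∀ x y, 0 ≤ K * A x y := fun x y => mul_nonneg hK0 (hA0 x y)
  refine mul_le_mul_of_nonneg_left ?_ (by positivity)
  refine Finset.sum_le_sum fun x0 _ => Finset.sum_le_sum fun x1 _ => ?_
  refine mul_le_mul (hfM _ _) ?_ ?_ (hM _ _).1
  · refine Finset.sum_le_sum fun x2 _ => ?_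
    refine mul_le_mul (hfK _ _) ?_ ?_ (hKA _ _)
    · refine Finset.sum_le_sum fun x3 _ => ?_
      exact mul_le_mul (hfK _ _) (hfK _ _) (hf0 _ _) (hKA _ _)
    · exact Finset.sum_nonneg fun x3 _ => mul_nonneg (hf0 _ _) (hf0 _ _)
  · exact Finset.sum_nonneg fun x2 _ => mul_nonneg (hf0 _ _)
      (Finset.sum_nonneg fun x3 _ => mul_nonneg (hf0 _ _) (hf0 _ _))

theorem density_step {V : Type*} [Fintype V] [Nonempty V] (T : SimpleGraph V) (l : ℕ) (hl : 1 ≤ l) :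
    homDensity (cycleGraph (2 * l + 1)) T ^ 4 ≤ homDensity (cycleGraph (2 * (l + 1) + 1)) T := by
  classical
  have h := trace_step T l hl
  unfold homDensity
  rw [card_hom_eq_trace T (2 * l) (by omega), card_hom_eq_trace T (2 * (l + 1)) (by omega)]
  simp only [Fintype.card_fin]
  have hn : (0:ℝ) < Fintype.card V := by exact_mod_cast Fintype.card_pos
  rw [div_pow, div_le_div_iff₀ (by positivity) (by positivity)]
  rw [show 2 * (l + 1) + 1 = 2 * l + 3 by ring]
  obtain ⟨j, rfl⟩ : ∃ j, l = j + 1 := ⟨l - 1, by omega⟩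
  rw [show 2 * (j + 1) - 1 = 2 * j + 1 by omega] at h
  refine (mul_le_mul_of_nonneg_right h (by positivity)).trans (le_of_eq ?_)
  ring

theorem domSet_nonempty (l j : ℕ) (hl : 1 ≤ l) :
    (domSet (cycleGraph (2 * (l + j) + 1)) (cycleGraph (2 * l + 1))).Nonempty := by
  refine ⟨((4 ^ j : ℕ) : ℝ), by positivity, fun n hn T => ?_⟩
  have : Nonempty (Fin n) := ⟨⟨0, hn⟩⟩
  rw [Real.rpow_natCast]
  induction j with
  | zero => simp
  | succ j ih =>
    refine le_trans ?_ (density_step T (l + j) (by omega))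
    rw [pow_succ, pow_mul]
    have : 0 ≤ homDensity (cycleGraph (2 * l + 1)) T := by unfold homDensity; positivity
    gcongr

theorem class_sum {F : Type*} [Field F] [DecidableEq F] (m : ℕ) (s a : Fin m → F)
    (h : ∀ j : Fin m, ∑ i, a i * s i ^ (j : ℕ) = 0) (σ : F) :
    ∑ i with s i = σ, a i = 0 := by
  classical
  by_cases hσ : ∃ i, s i = σ
  swap
  · push Not at hσ
    rw [Finset.filter_false_of_mem (fun i _ => hσ i), Finset.sum_empty]
  have hpoly : ∀ P : Polynomial F, P.natDegree < m → ∑ i, a i * P.eval (s i) = 0 := by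
    intro P hP
    simp only [Polynomial.eval_eq_sum_range' hP, Finset.mul_sum]
    rw [Finset.sum_comm]
    refine Finset.sum_eq_zero fun j hj => ?_
    have := h ⟨j, Finset.mem_range.1 hj⟩
    simp only at this
    calc _ = ∑ i, P.coeff j * (a i * s i ^ j) := Finset.sum_congr rfl fun i _ => by ring
      _ = 0 := by rw [← Finset.mul_sum, this, mul_zero]
  set I := (Finset.univ.image s).erase σ with hI
  have hcard : I.card < m := by
    obtain ⟨i, hi⟩ := hσ
    have h1 : σ ∈ Finset.univ.image s := by simp; exact ⟨i, hi⟩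
    have h2 := Finset.card_erase_lt_of_mem h1
    have h3 := Finset.card_image_le (s := (Finset.univ : Finset (Fin m))) (f := s)
    simp only [Finset.card_univ, Fintype.card_fin] at h3
    rw [hI]; omega
  have h0 := hpoly (∏ τ ∈ I, (Polynomial.X - Polynomial.C τ)) (by
    rw [Polynomial.natDegree_finsetProd_X_sub_C_eq_card]; exact hcard)
  have hne : ∏ τ ∈ I, (σ - τ) ≠ 0 := by
    rw [Finset.prod_ne_zero_iff]
    intro τ hτ
    rw [sub_ne_zero]
    exact (Finset.ne_of_mem_erase hτ).symm
  have h1 : (∑ i with s i = σ, a i) * ∏ τ ∈ I, (σ - τ) = 0 := by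
    rw [← h0, Finset.sum_mul, Finset.sum_filter]
    refine Finset.sum_congr rfl fun i _ => ?_
    split_ifs with hi
    · simp [Polynomial.eval_prod, hi]
    · rw [Polynomial.eval_prod, Finset.prod_eq_zero (i := s i), mul_zero]
      · rw [hI, Finset.mem_erase]; exact ⟨hi, by simp⟩
      · simp
  exact (mul_eq_zero.1 h1).resolve_right hne

/-- Pairs `(s, a)` with `∑ a i * v (s i) = 0`, `v` the moment curve. -/
def MomSol (F : Type*) [Field F] (m : ℕ) : Type _ :=
  {q : (Fin m → F) × (Fin m → F) // ∀ j : Fin m, ∑ i, q.2 i * q.1 i ^ (j : ℕ) = 0}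

theorem momSol_inj (F : Type*) [Field F] (N : ℕ) :
    ∃ g : MomSol F (N + 1) → (Fin (N + 1) → Fin (N + 1)) × (Fin (N + 1) → F),
      Function.Injective g := by
  classical
  let r : (Fin (N + 1) → F) → Fin (N + 1) → Fin (N + 1) := fun s i => Function.invFun s (s i)
  have hr : ∀ (s : Fin (N + 1) → F) (i : Fin (N + 1)), s (r s i) = s i := fun s i => Function.invFun_eq ⟨i, rfl⟩
  refine ⟨fun q => (r q.1.1, fun i => if r q.1.1 i = i then q.1.1 i else q.1.2 i), ?_⟩
  rintro ⟨⟨s, a⟩, hq⟩ ⟨⟨s', a'⟩, hq'⟩ heq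
  simp only [Prod.mk.injEq] at heq
  obtain ⟨h1, h2⟩ := heq
  have hrr : ∀ i, r s (r s i) = r s i := fun i => by
    show Function.invFun s (s (r s i)) = Function.invFun s (s i)
    rw [hr s]
  have hs : s = s' := by
    funext i
    have := congrFun h2 (r s i)
    rw [← h1] at this
    simp only [hrr, if_true] at this
    rw [hr s] at this
    rw [this, h1, hr s']
  subst hs
  have hne : ∀ i, r s i ≠ i → a i = a' i := fun i hi => by
    have := congrFun h2 i
    simpa [hi] using this
  have ha : a = a' := by
    funext i
    by_cases hi : r s i = i
    · have e1 := class_sum _ s a hq (s i)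
      have e2 := class_sum _ s a' hq' (s i)
      rw [← Finset.add_sum_erase _ _ (show i ∈ Finset.univ.filter (fun j => s j = s i) by simp)]
        at e1 e2
      have : ∑ x ∈ (Finset.univ.filter (fun j => s j = s i)).erase i, a x =
          ∑ x ∈ (Finset.univ.filter (fun j => s j = s i)).erase i, a' x := by
        refine Finset.sum_congr rfl fun j hj => hne j ?_
        rw [Finset.mem_erase, Finset.mem_filter] at hj
        have : r s j = r s i := by
          show Function.invFun s (s j) = Function.invFun s (s i)
          rw [hj.2.2]
        rw [this, hi]
        exact fun h => hj.1 h.symm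
      rw [this] at e1
      exact add_right_cancel (e1.trans e2.symm)
    · exact hne i hi
  subst ha
  rfl

/-- The Cayley graph of `F^m` generated by multiples of points of the moment curve. -/
def momGraph (F : Type*) [Field F] (m : ℕ) : SimpleGraph (Fin m → F) where
  Adj x y := x ≠ y ∧ ∃ s a : F, ∀ j : Fin m, y j - x j = a * s ^ (j : ℕ)
  symm := ⟨by
    rintro x y ⟨hne, s, a, h⟩
    exact ⟨hne.symm, s, -a, fun j => by rw [neg_mul, ← h j]; ring⟩⟩
  loopless := ⟨fun x h => h.1 rfl⟩

theorem upper_count (F : Type*) [Field F] [Fintype F] (N : ℕ) (hN : 1 ≤ N) :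
    Nat.card (cycleGraph (N + 1) →g momGraph F (N + 1)) ≤
      Fintype.card F ^ (N + 1) * ((N + 1) ^ (N + 1) * Fintype.card F ^ (N + 1)) := by
  classical
  obtain ⟨g, hg⟩ := momSol_inj F N
  rw [Nat.card_congr (cycHomEquiv _ N hN)]
  have hex : ∀ h : {h : Fin (N + 1) → (Fin (N + 1) → F) //
      ∀ i, (momGraph F (N + 1)).Adj (h i) (h (i + 1))}, ∃ q : MomSol F (N + 1),
      ∀ i j, h.1 (i + 1) j - h.1 i j = q.1.2 i * q.1.1 i ^ (j : ℕ) := by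
    rintro ⟨h, hh⟩
    choose s a hsa using fun i => (hh i).2
    refine ⟨⟨(s, a), fun j => ?_⟩, hsa⟩
    simp only [← hsa, Finset.sum_sub_distrib]
    rw [sub_eq_zero]
    exact Equiv.sum_comp (Equiv.addRight (1 : Fin (N + 1))) (fun i => h i j)
  choose q hq using hex
  have hinj : Function.Injective (fun h : {h : Fin (N + 1) → (Fin (N + 1) → F) //
      ∀ i, (momGraph F (N + 1)).Adj (h i) (h (i + 1))} => (h.1 0, g (q h))) := by
    intro h h' heq
    simp only [Prod.mk.injEq] at heq
    obtain ⟨e0, e1⟩ := heq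
    have e2 := hg e1
    apply Subtype.ext
    funext i
    induction i using Fin.induction with
    | zero => exact e0
    | succ i ih =>
      funext j
      have a1 := hq h i.castSucc j
      have a2 := hq h' i.castSucc j
      rw [← e2, ← a1, ih, Fin.coeSucc_eq_succ] at a2
      exact (sub_left_injective a2).symm
  refine (Nat.card_le_card_of_injective _ hinj).trans (le_of_eq ?_)
  simp [Nat.card_eq_fintype_card]

theorem lower_count (p h m l : ℕ) [Fact p.Prime] (hp : p = 2 * h + 1) (hm : 2 ≤ m) (hl : 1 ≤ l) :
    p ^ m * (p * h ^ (2 * l)) ≤ Nat.card (cycleGraph (2 * l + 1) →g momGraph (ZMod p) m) := by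
  classical
  rw [Nat.card_congr (cycHomEquiv _ (2 * l) (by omega))]
  let c : (Fin (2 * l) → Fin h) → Fin (2 * l + 1) → ℕ := fun u =>
    Fin.cons (α := fun _ => ℕ) 0 (fun i => 2 * (u i : ℕ) + 1 + (i : ℕ) % 2)
  have c0 : ∀ u, c u 0 = 0 := fun u => rfl
  have cs : ∀ u i, c u (Fin.succ i) = 2 * (u i : ℕ) + 1 + (i : ℕ) % 2 := fun u i => by simp [c]
  have clt : ∀ u i, c u i < p := by
    intro u i
    induction i using Fin.cases with
    | zero => rw [c0]; omega
    | succ i => rw [cs]; have := (u i).2; omega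
  have cne : ∀ u i, c u i ≠ c u (i + 1) := by
    intro u i
    induction i using Fin.lastCases with
    | last =>
      rw [Fin.last_add_one, c0]
      obtain ⟨j, hj⟩ : ∃ j : Fin (2 * l), Fin.last (2 * l) = j.succ :=
        ⟨⟨2 * l - 1, by omega⟩, by ext; simp; omega⟩
      rw [hj, cs]; omega
    | cast i =>
      rw [Fin.coeSucc_eq_succ, cs]
      by_cases hi : (i : ℕ) = 0
      · have : i.castSucc = 0 := by ext; simpa using hi
        rw [this, c0]; omega
      · obtain ⟨j, hj⟩ : ∃ j : Fin (2 * l), i.castSucc = j.succ :=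
          ⟨⟨i - 1, by omega⟩, by ext; simp; omega⟩
        rw [hj, cs]
        have := congrArg Fin.val hj
        simp at this
        omega
  have cinj : ∀ x y : ℕ, x < p → y < p → (x : ZMod p) = (y : ZMod p) → x = y := by
    intro x y hx hy hxy
    rw [ZMod.natCast_eq_natCast_iff'] at hxy
    rwa [Nat.mod_eq_of_lt hx, Nat.mod_eq_of_lt hy] at hxy
  let Φ : (Fin m → ZMod p) × ZMod p × (Fin (2 * l) → Fin h) →
      {f : Fin (2 * l + 1) → (Fin m → ZMod p) //
        ∀ i, (momGraph (ZMod p) m).Adj (f i) (f (i + 1))} := fun t =>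
    ⟨fun i j => t.1 j + (c t.2.2 i : ZMod p) * t.2.1 ^ (j : ℕ), fun i => by
      refine ⟨fun heq => ?_, t.2.1, (c t.2.2 (i + 1) : ZMod p) - c t.2.2 i, fun j => by ring⟩
      have := congrFun heq ⟨0, by omega⟩
      simp only [pow_zero, mul_one, add_right_inj] at this
      exact cne _ _ (cinj _ _ (clt _ _) (clt _ _) this)⟩
  have hΦ : Function.Injective Φ := by
    rintro ⟨x, s, u⟩ ⟨x', s', u'⟩ heq
    have H : ∀ i j, x j + (c u i : ZMod p) * s ^ (j : ℕ) =
        x' j + (c u' i : ZMod p) * s' ^ (j : ℕ) := fun i j =>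
      congrFun (congrFun (congrArg Subtype.val heq) i) j
    have hx : x = x' := by
      funext j
      simpa [c0] using H 0 j
    subst hx
    have hc : ∀ i, c u i = c u' i := fun i => by
      have := H i ⟨0, by omega⟩
      simp only [pow_zero, mul_one, add_right_inj] at this
      exact cinj _ _ (clt _ _) (clt _ _) this
    have hu : u = u' := by
      funext i
      have := hc i.succ
      rw [cs, cs] at this
      ext; omega
    subst hu
    have hs : s = s' := by
      have h1 := H (Fin.succ ⟨0, by omega⟩) ⟨1, by omega⟩
      simp only [pow_one, add_right_inj] at h1
      refine mul_left_cancel₀ ?_ h1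
      intro h0
      have := cinj _ 0 (clt _ _) (by omega) (h0.trans Nat.cast_zero.symm)
      rw [cs] at this
      omega
    subst hs
    rfl
  refine le_trans (le_of_eq ?_) (Nat.card_le_card_of_injective Φ hΦ)
  simp [Nat.card_eq_fintype_card, ZMod.card]

theorem key_ineq (k l : ℕ) (hl : 1 ≤ l) (hlk : l < k) (c : ℝ)
    (hc : c ∈ domSet (cycleGraph (2*k+1)) (cycleGraph (2*l+1))) (p : ℕ) (hp : p.Prime)
    (hp3 : 3 ≤ p) :
    ((1 / 3 : ℝ) ^ (2 * l)) ^ c ≤ ((2 * k + 1 : ℕ) : ℝ) ^ (2 * k + 1) *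
      (p : ℝ) ^ ((4 * (k:ℝ) * l - 1) * c - (4 * (k:ℝ) ^ 2 - 1)) := by
  classical
  have : Fact p.Prime := ⟨hp⟩
  obtain ⟨hc0, hc⟩ := hc
  obtain ⟨h, hh⟩ : ∃ h, p = 2 * h + 1 := hp.odd_of_ne_two (by omega)
  have hp0 : (0:ℝ) < p := by exact_mod_cast hp.pos
  have hcard : Fintype.card (Fin (2 * k + 1) → ZMod p) = p ^ (2 * k + 1) := by simp [ZMod.card]
  let e : (Fin (2 * k + 1) → ZMod p) ≃ Fin (p ^ (2 * k + 1)) := Fintype.equivFinOfCardEq hcard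
  let T := (momGraph (ZMod p) (2 * k + 1)).map e.toEmbedding
  let ι : momGraph (ZMod p) (2 * k + 1) ≃g T := SimpleGraph.Iso.map e _
  have hhom : ∀ N : ℕ, Nat.card (cycleGraph N →g T) =
      Nat.card (cycleGraph N →g momGraph (ZMod p) (2 * k + 1)) := fun N =>
    Nat.card_congr
      { toFun := fun f => ι.symm.toHom.comp f
        invFun := fun f => ι.toHom.comp f
        left_inv := fun f => by ext x; simp
        right_inv := fun f => by ext x; simp }
  have hT := hc (p ^ (2 * k + 1)) (by positivity) T
  unfold homDensity at hT
  rw [hhom, hhom] at hT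
  simp only [Fintype.card_fin] at hT
  have hU := upper_count (ZMod p) (2 * k) (by omega)
  have hL := lower_count p h (2 * k + 1) l hh (by omega) hl
  rw [ZMod.card] at hU
  have hU' : (Nat.card (cycleGraph (2 * k + 1) →g momGraph (ZMod p) (2 * k + 1)) : ℝ) ≤
      (p : ℝ) ^ (2 * k + 1) * (((2 * k + 1 : ℕ) : ℝ) ^ (2 * k + 1) * (p : ℝ) ^ (2 * k + 1)) := by
    exact_mod_cast hU
  have hL' : (p : ℝ) ^ (2 * k + 1) * (p * (h : ℝ) ^ (2 * l)) ≤
      (Nat.card (cycleGraph (2 * l + 1) →g momGraph (ZMod p) (2 * k + 1)) : ℝ) := by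
    exact_mod_cast hL
  have hh3 : (1 / 3 : ℝ) * p ≤ h := by
    have : p ≤ 3 * h := by omega
    have : (p : ℝ) ≤ 3 * h := by exact_mod_cast this
    linarith
  have hA : (1 / 3 : ℝ) ^ (2 * l) * (p : ℝ) ^ (-(4 * (k:ℝ) * l - 1)) ≤
      (Nat.card (cycleGraph (2 * l + 1) →g momGraph (ZMod p) (2 * k + 1)) : ℝ) /
        ((p ^ (2 * k + 1) : ℕ) : ℝ) ^ (2 * l + 1) := by
    rw [le_div_iff₀ (by positivity)]
    refine le_trans (le_trans (le_of_eq ?_) (show (p : ℝ) ^ (2 * k + 1) *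
      (p * ((1 / 3 : ℝ) * p) ^ (2 * l)) ≤ _ by gcongr)) hL'
    rw [mul_pow]
    push_cast
    have : (p : ℝ) ^ (-(4 * (k:ℝ) * l - 1)) * ((p : ℝ) ^ (2 * k + 1)) ^ (2 * l + 1) =
        (p : ℝ) ^ (2 * k + 1) * (p * (p : ℝ) ^ (2 * l)) := by
      rw [← pow_mul, ← pow_succ', ← pow_add, ← Real.rpow_natCast (p : ℝ), ← Real.rpow_natCast (p : ℝ),
        ← Real.rpow_add hp0]
      congr 1
      push_cast
      ring
    rw [mul_assoc, this]; ring
  have hB : (Nat.card (cycleGraph (2 * k + 1) →g momGraph (ZMod p) (2 * k + 1)) : ℝ) /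
        ((p ^ (2 * k + 1) : ℕ) : ℝ) ^ (2 * k + 1) ≤
      ((2 * k + 1 : ℕ) : ℝ) ^ (2 * k + 1) * (p : ℝ) ^ (-(4 * (k:ℝ) ^ 2 - 1)) := by
    rw [div_le_iff₀ (by positivity)]
    refine hU'.trans (le_of_eq ?_)
    have : (p : ℝ) ^ (-(4 * (k:ℝ) ^ 2 - 1)) * ((p : ℝ) ^ (2 * k + 1)) ^ (2 * k + 1) =
        (p : ℝ) ^ (2 * k + 1) * (p : ℝ) ^ (2 * k + 1) := by
      rw [← pow_mul, ← pow_add, ← Real.rpow_natCast (p : ℝ), ← Real.rpow_natCast (p : ℝ),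
        ← Real.rpow_add hp0]
      congr 1
      push_cast
      ring
    rw [Nat.cast_pow, mul_assoc, this]; ring
  have hfin := (Real.rpow_le_rpow (by positivity) hA hc0).trans (hT.trans hB)
  rw [Real.mul_rpow (by positivity) (by positivity), ← Real.rpow_mul hp0.le] at hfin
  have hpos : (0:ℝ) < (p:ℝ) ^ ((4 * (k:ℝ) * l - 1) * c) := by positivity
  have := mul_le_mul_of_nonneg_right hfin hpos.le
  rw [mul_assoc, ← Real.rpow_add hp0, mul_assoc (((2 * k + 1 : ℕ) : ℝ) ^ (2 * k + 1)),
    ← Real.rpow_add hp0] at this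
  rw [show -(4 * (k:ℝ) * l - 1) * c + (4 * (k:ℝ) * l - 1) * c = 0 by ring, Real.rpow_zero,
    mul_one] at this
  refine this.trans (le_of_eq ?_)
  congr 2
  ring

theorem stmt_12 (k l : ℕ) (hl : 1 ≤ l) (hlk : l < k) :
    (4*(k:ℝ)^2 - 1) / (4*(k:ℝ)*(l:ℝ) - 1) ≤
      domExp (cycleGraph (2*k+1)) (cycleGraph (2*l+1)) := by
  have hl' : (1:ℝ) ≤ l := by exact_mod_cast hl
  have hk' : (1:ℝ) ≤ k := by exact_mod_cast (by omega : 1 ≤ k)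
  have hpos : (0:ℝ) < 4*(k:ℝ)*(l:ℝ) - 1 := by nlinarith
  unfold domExp
  refine le_csInf ?_ fun c hc => ?_
  · have := domSet_nonempty l (k - l) hl
    rwa [show l + (k - l) = k by omega] at this
  rw [div_le_iff₀ hpos]
  by_contra hlt
  push Not at hlt
  set β := (4*(k:ℝ)^2 - 1) - (4*(k:ℝ)*(l:ℝ) - 1) * c with hβ
  have hβ0 : 0 < β := by rw [hβ]; linarith
  have hlim : Filter.Tendsto (fun p : ℕ => ((2 * k + 1 : ℕ) : ℝ) ^ (2 * k + 1) *
      (p : ℝ) ^ (-β)) Filter.atTop (nhds (((2 * k + 1 : ℕ) : ℝ) ^ (2 * k + 1) * 0)) :=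
    ((tendsto_rpow_neg_atTop hβ0).comp tendsto_natCast_atTop_atTop).const_mul _
  rw [mul_zero] at hlim
  have hc1 : (0:ℝ) < ((1 / 3 : ℝ) ^ (2 * l)) ^ c := by positivity
  obtain ⟨M, hM⟩ := Filter.eventually_atTop.1 (hlim.eventually (gt_mem_nhds hc1))
  obtain ⟨p, hpM, hp⟩ := Nat.exists_infinite_primes (M + 3)
  have h1 := hM p (by omega)
  have h2 := key_ineq k l hl hlk c hc p hp (by omega)
  rw [show (4 * (k:ℝ) * l - 1) * c - (4 * (k:ℝ) ^ 2 - 1) = -β by rw [hβ]; ring] at h2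
  exact absurd h1 (not_lt.2 h2)
end

section
/- Let H_1 and H_2 be finite simple graphs, each with at least one edge, such that H_1 is a subgraph of H_2 (not necessarily spanning) and ν*(H_1) = ν*(H_2), where ν*(H) denotes the fractional matching number of H. Then C(H_1, H_2) = 1. -/
open SimpleGraph

open scoped Classical in
/-- The fractional matching number `ν*(H)`. -/
noncomputable def fracNu {α : Type*} [Fintype α] (H : SimpleGraph α) : ℝ :=
  sSup {x : ℝ | ∃ w : Sym2 α → ℝ,
    (∀ e, 0 ≤ w e ∧ w e ≤ 1) ∧
    (∀ e, e ∉ H.edgeSet → w e = 0) ∧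
    (∀ v : α, ∑ e ∈ Finset.univ.filter (fun e : Sym2 α => v ∈ e), w e ≤ 1) ∧
    x = ∑ e : Sym2 α, w e}

open scoped Classical in
/-- Weak duality. -/
lemma weak_dual {α : Type*} [Fintype α] (H : SimpleGraph α) (c : α → ℕ)
    (hc : ∀ u v, H.Adj u v → 2 ≤ c u + c v) (w : Sym2 α → ℝ)
    (h0 : ∀ e, 0 ≤ w e ∧ w e ≤ 1) (h1 : ∀ e, e ∉ H.edgeSet → w e = 0)
    (h2 : ∀ v : α, ∑ e ∈ Finset.univ.filter (fun e : Sym2 α => v ∈ e), w e ≤ 1) :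
    ∑ e : Sym2 α, w e ≤ ((∑ v, c v : ℕ) : ℝ) / 2 := by
  have key : ∀ e : Sym2 α, 2 * w e ≤ ∑ v : α, if v ∈ e then (c v : ℝ) * w e else 0 := by
    intro e
    by_cases he : e ∈ H.edgeSet
    · induction e using Sym2.ind with
      | _ a b =>
        have hab : H.Adj a b := he
        have hsub : ∑ v ∈ ({a, b} : Finset α), (if v ∈ s(a, b) then (c v : ℝ) * w s(a, b) else 0)
            ≤ ∑ v : α, if v ∈ s(a, b) then (c v : ℝ) * w s(a, b) else 0 := by
          apply Finset.sum_le_sum_of_subset_of_nonneg (Finset.subset_univ _)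
          intro i _ _
          have := (h0 s(a, b)).1
          split_ifs <;> positivity
        refine le_trans ?_ hsub
        rw [Finset.sum_pair hab.ne]
        simp only [Sym2.mem_iff, true_or, or_true, if_true]
        have h3 : (2 : ℝ) ≤ c a + c b := by exact_mod_cast hc a b hab
        have := (h0 s(a, b)).1
        nlinarith
    · rw [h1 e he]; simp
  have h3 : ∑ e : Sym2 α, 2 * w e ≤ ∑ v, (c v : ℝ) := by
    calc _ ≤ ∑ e : Sym2 α, ∑ v : α, (if v ∈ e then (c v : ℝ) * w e else 0) :=
          Finset.sum_le_sum fun e _ => key e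
      _ = ∑ v : α, ∑ e : Sym2 α, (if v ∈ e then (c v : ℝ) * w e else 0) := Finset.sum_comm
      _ ≤ _ := by
        apply Finset.sum_le_sum
        intro v _
        rw [← Finset.sum_filter, ← Finset.mul_sum]
        have := h2 v
        have h4 : (0 : ℝ) ≤ c v := by positivity
        nlinarith
  rw [← Finset.mul_sum] at h3
  push_cast
  linarith

lemma fracNu_le {α : Type*} [Fintype α] (H : SimpleGraph α) (c : α → ℕ)
    (hc : ∀ u v, H.Adj u v → 2 ≤ c u + c v) : fracNu H ≤ ((∑ v, c v : ℕ) : ℝ) / 2 := by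
  unfold fracNu
  apply csSup_le
  · exact ⟨0, fun _ => 0, by simp⟩
  · rintro x ⟨w, h0, h1, h2, rfl⟩
    exact weak_dual H c hc w h0 h1 h2

open scoped Classical in
lemma le_fracNu {α : Type*} [Fintype α] (H : SimpleGraph α) (w : Sym2 α → ℝ)
    (h0 : ∀ e, 0 ≤ w e ∧ w e ≤ 1) (h1 : ∀ e, e ∉ H.edgeSet → w e = 0)
    (h2 : ∀ v : α, ∑ e ∈ Finset.univ.filter (fun e : Sym2 α => v ∈ e), w e ≤ 1) :
    ∑ e : Sym2 α, w e ≤ fracNu H := by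
  unfold fracNu
  apply le_csSup
  · refine ⟨((∑ v : α, 2 : ℕ) : ℝ) / 2, ?_⟩
    rintro x ⟨w, h0, h1, h2, rfl⟩
    exact weak_dual H (fun _ => 2) (by simp) w h0 h1 h2
  · exact ⟨w, h0, h1, h2, rfl⟩

open scoped Classical in
/-- Half-integral strong duality, through Hall's theorem. -/
lemma exists_cover {α : Type*} [Fintype α] (H : SimpleGraph α) :
    ∃ c : α → ℕ, (∀ v, c v ≤ 2) ∧ (∀ u v, H.Adj u v → 2 ≤ c u + c v) ∧
      ((∑ v, c v : ℕ) : ℝ) / 2 ≤ fracNu H := by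
  let N : Finset α → Finset α := fun S => Finset.univ.filter fun v => ∃ u ∈ S, H.Adj u v
  obtain ⟨S, -, hS⟩ := Finset.exists_max_image (Finset.univ : Finset (Finset α))
    (fun S => S.card - (N S).card) ⟨∅, Finset.mem_univ _⟩
  set d := S.card - (N S).card with hd
  -- we may need that the true difference is nonnegative: otherwise use the empty set
  obtain ⟨S, hSd, hmax⟩ : ∃ S : Finset α, S.card = (N S).card + d ∧
      ∀ S' : Finset α, S'.card ≤ (N S').card + d := by
    have hm : ∀ S' : Finset α, S'.card ≤ (N S').card + d := by
      intro S'
      have := hS S' (Finset.mem_univ _)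
      omega
    by_cases h : (N S).card ≤ S.card
    · exact ⟨S, by omega, hm⟩
    · refine ⟨∅, ?_, hm⟩
      have : N ∅ = ∅ := by simp [N]
      rw [this]; simp; omega
  refine ⟨fun v => (if v ∈ N S then 1 else 0) + (if v ∈ S then 0 else 1), ?_, ?_, ?_⟩
  · intro v; dsimp only; split_ifs <;> omega
  · intro u v huv
    have ha : u ∈ S → v ∈ N S := fun h => by simp only [N, Finset.mem_filter, Finset.mem_univ, true_and]; exact ⟨u, h, huv⟩
    have hb : v ∈ S → u ∈ N S := fun h => by simp only [N, Finset.mem_filter, Finset.mem_univ, true_and]; exact ⟨v, h, huv.symm⟩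
    dsimp only
    split_ifs <;> first | omega | tauto
  -- Hall
  let t : α → Finset (α ⊕ Fin d) := fun v => (N {v}).disjSum Finset.univ
  obtain ⟨f, hfi, hft⟩ := (Finset.all_card_le_biUnion_card_iff_exists_injective t).1 (by
    intro S'
    rcases S'.eq_empty_or_nonempty with rfl | hne
    · simp
    have : S'.biUnion t = (N S').disjSum Finset.univ := by
      ext x
      rcases x with x | x
      · simp [t, N]
      · simp [t]; exact hne
    rw [this, Finset.card_disjSum]
    simpa using hmax S')
  have hadj : ∀ v u, f v = Sum.inl u → H.Adj v u := by
    intro v u h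
    have := hft v
    rw [h] at this
    simpa [t, N] using this
  let g : α → Option (Sym2 α) := fun v => Sum.elim (fun u => some s(v, u)) (fun _ => none) (f v)
  have hg : ∀ v e, g v = some e → ∃ u, f v = Sum.inl u ∧ e = s(v, u) := by
    intro v e h
    rcases hfv : f v with u | u
    · simp [g, hfv] at h; exact ⟨u, rfl, h.symm⟩
    · simp [g, hfv] at h
  let w : Sym2 α → ℝ := fun e => ∑ v : α, if g v = some e then (1/2 : ℝ) else 0
  have w0 : ∀ e, 0 ≤ w e := fun e => Finset.sum_nonneg fun v _ => by split_ifs <;> norm_num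
  have wv : ∀ v : α, ∑ e ∈ Finset.univ.filter (fun e : Sym2 α => v ∈ e), w e ≤ 1 := by
    intro v
    have hle : ∀ a : α, (∑ e ∈ Finset.univ.filter (fun e : Sym2 α => v ∈ e),
        if g a = some e then (1/2 : ℝ) else 0) ≤
        (if a = v then 1/2 else 0) + (if f a = Sum.inl v then 1/2 else 0) := by
      intro a
      rcases hga : g a with _ | e0
      · simp; split_ifs <;> norm_num
      · obtain ⟨u, hu, rfl⟩ := hg _ _ hga
        simp only [Option.some.injEq, Finset.sum_ite_eq, Finset.mem_filter, Finset.mem_univ,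
          true_and, Sym2.mem_iff, hu, Sum.inl.injEq]
        by_cases h1 : a = v <;> by_cases h2 : u = v <;> simp [h1, h2] <;> norm_num
        rw [if_neg]
        rintro (h | h) <;> simp_all
    calc _ = ∑ a : α, ∑ e ∈ Finset.univ.filter (fun e : Sym2 α => v ∈ e),
        (if g a = some e then (1/2 : ℝ) else 0) := Finset.sum_comm
      _ ≤ ∑ a : α, ((if a = v then (1/2:ℝ) else 0) + (if f a = Sum.inl v then 1/2 else 0)) :=
        Finset.sum_le_sum fun a _ => hle a
      _ ≤ 1 := by
        rw [Finset.sum_add_distrib]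
        have e1 : ∑ a : α, (if a = v then (1/2:ℝ) else 0) = 1/2 := by simp
        have e2 : ∑ a : α, (if f a = Sum.inl v then (1/2:ℝ) else 0) ≤ 1/2 := by
          rw [← Finset.sum_filter, Finset.sum_const, nsmul_eq_mul]
          have : (Finset.univ.filter fun a => f a = Sum.inl v).card ≤ 1 := by
            apply Finset.card_le_one.2
            intro a ha b hb
            simp only [Finset.mem_filter, Finset.mem_univ, true_and] at ha hb
            exact hfi (ha.trans hb.symm)
          have : ((Finset.univ.filter fun a => f a = Sum.inl v).card : ℝ) ≤ 1 := by
            exact_mod_cast this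
          linarith
        linarith
  have w1 : ∀ e, w e ≤ 1 := by
    intro e
    induction e using Sym2.ind with
    | _ a b =>
      refine le_trans ?_ (wv a)
      exact Finset.single_le_sum (f := w) (fun e _ => w0 e) (by simp)
  have wn : ∀ e, e ∉ H.edgeSet → w e = 0 := by
    intro e he
    apply Finset.sum_eq_zero
    intro v _
    rw [if_neg]
    intro h
    obtain ⟨u, hu, rfl⟩ := hg _ _ h
    exact he (hadj v u hu)
  refine le_trans ?_ (le_fracNu H w (fun e => ⟨w0 e, w1 e⟩) wn wv)
  -- total weight
  have htot : ∑ e, w e = ∑ a : α, (if (f a).isLeft then (1/2:ℝ) else 0) := by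
    calc _ = ∑ a : α, ∑ e : Sym2 α, (if g a = some e then (1/2 : ℝ) else 0) := Finset.sum_comm
      _ = _ := by
        apply Finset.sum_congr rfl
        intro a _
        rcases hfa : f a with u | u <;> simp [g, hfa]
  have hright : (Finset.univ.filter fun a => ¬ (f a).isLeft = true).card ≤ d := by
    have : ((Finset.univ.filter fun a => ¬ (f a).isLeft = true).image f).card ≤
        ((Finset.univ : Finset (Fin d)).image (Sum.inr : Fin d → α ⊕ Fin d)).card := by
      apply Finset.card_le_card
      intro x hx
      simp only [Finset.mem_image, Finset.mem_filter, Finset.mem_univ, true_and] at hx ⊢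
      obtain ⟨a, ha, rfl⟩ := hx
      rcases hfa : f a with u | u
      · simp [hfa] at ha
      · exact ⟨u, rfl⟩
    rw [Finset.card_image_of_injective _ hfi, Finset.card_image_of_injective _ Sum.inr_injective] at this
    simpa using this
  have hsplit := Finset.card_filter_add_card_filter_not (s := (Finset.univ : Finset α)) (fun a => (f a).isLeft = true)
  rw [htot, ← Finset.sum_filter, Finset.sum_const, nsmul_eq_mul]
  have hsum : (∑ v, ((if v ∈ N S then 1 else 0) + (if v ∈ S then 0 else 1)) : ℕ)
      ≤ (Finset.univ.filter fun a => (f a).isLeft = true).card := by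
    rw [Finset.sum_add_distrib]
    have e1 : (∑ v, (if v ∈ N S then 1 else 0) : ℕ) = (N S).card := by simp
    have e2 : (∑ v, (if v ∈ S then 0 else 1) : ℕ) + S.card = Fintype.card α := by
      have : S.card = ∑ v, (if v ∈ S then 1 else 0) := by simp
      rw [this, ← Finset.sum_add_distrib, ← Finset.card_univ, Finset.card_eq_sum_ones]
      apply Finset.sum_congr rfl
      intro v _; split_ifs <;> rfl
    rw [Finset.card_univ] at hsplit
    omega
  have : ((∑ v, ((if v ∈ N S then 1 else 0) + (if v ∈ S then 0 else 1)) : ℕ) : ℝ)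
      ≤ ((Finset.univ.filter fun a => (f a).isLeft = true).card : ℝ) := by exact_mod_cast hsum
  linarith

/-- Transport of the target along an equivalence. -/
lemma homDensity_comap {α β γ : Type*} [Fintype α] [Fintype β] [Fintype γ]
    (G : SimpleGraph α) (T : SimpleGraph β) (e : γ ≃ β) :
    homDensity G (T.comap e) = homDensity G T := by
  unfold homDensity
  rw [Fintype.card_congr e]
  congr 2
  apply Nat.card_congr
  refine ⟨fun φ => ⟨fun x => e (φ x), fun h => φ.map_rel h⟩,
    fun φ => ⟨fun x => e.symm (φ x), fun h => ?_⟩, ?_, ?_⟩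
  · simpa using φ.map_rel h
  · intro φ; apply DFunLike.ext; intro x; exact e.symm_apply_apply _
  · intro φ; apply DFunLike.ext; intro x; exact e.apply_symm_apply _

def lev (m i : ℕ) : ℕ := if i < 1 then 2 else if i < m then 1 else 0

/-- The target graph. -/
def tgt (β : Type*) (m : ℕ) : SimpleGraph (β × Fin (m ^ 2)) where
  Adj x y := x.1 ≠ y.1 ∧ 2 ≤ lev m x.2 + lev m y.2
  symm := ⟨fun x y h => ⟨h.1.symm, by have := h.2; omega⟩⟩
  loopless := ⟨fun x h => h.1 rfl⟩

lemma lev_ge (m c i : ℕ) (hc : c ≤ 2) (hi : i < m ^ (2 - c)) : c ≤ lev m i := by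
  unfold lev
  interval_cases c
  · omega
  · simp at hi; split_ifs <;> omega
  · simp at hi; simp [hi]

lemma lev_lt (m c i : ℕ) (hi : i < m ^ 2) (h : lev m i = c) : i < m ^ (2 - c) := by
  unfold lev at h
  split_ifs at h <;> subst h <;> simp_all

lemma prod_pow_aux {α : Type*} [Fintype α] (c : α → ℕ) (hc : ∀ v, c v ≤ 2) (m : ℕ) :
    (∏ v, m ^ (2 - c v)) * m ^ (∑ v, c v) = (m ^ 2) ^ Fintype.card α := by
  rw [← Finset.prod_pow_eq_pow_sum, ← Finset.prod_mul_distrib, ← Finset.card_univ,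
    ← Finset.prod_const]
  apply Finset.prod_congr rfl
  intro v _
  rw [← pow_add]; congr 1; have := hc v; omega

/-- Lower bound. -/
lemma hom_lower {β : Type*} [Fintype β] (H : SimpleGraph β) (c : β → ℕ) (hc : ∀ v, c v ≤ 2)
    (hcov : ∀ u v, H.Adj u v → 2 ≤ c u + c v) (m : ℕ) (hm : 0 < m) :
    ∏ v, m ^ (2 - c v) ≤ Nat.card (H →g tgt β m) := by
  classical
  have hle : ∀ v, m ^ (2 - c v) ≤ m ^ 2 := fun v => Nat.pow_le_pow_right hm (by omega)
  let F : (∀ v, Fin (m ^ (2 - c v))) → (H →g tgt β m) := fun g =>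
    ⟨fun v => (v, Fin.castLE (hle v) (g v)), fun {u v} h => ⟨h.ne, by
      have h1 := lev_ge m (c u) (g u) (hc u) (g u).2
      have h2 := lev_ge m (c v) (g v) (hc v) (g v).2
      have h3 := hcov u v h
      simp only [Fin.val_castLE]
      omega⟩⟩
  have hF : Function.Injective F := by
    intro g g' h
    funext v
    have := congrArg (fun φ : H →g tgt β m => ((φ v).2 : ℕ)) h
    exact Fin.ext this
  have : Finite (H →g tgt β m) := Finite.of_injective (fun φ => (φ : β → _)) DFunLike.coe_injective
  have := Nat.card_le_card_of_injective F hF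
  simpa using this

/-- Upper bound. -/
lemma hom_upper {α β : Type*} [Fintype α] [Fintype β] (H : SimpleGraph α) (k : ℕ)
    (hk : ∀ c : α → ℕ, (∀ u v, H.Adj u v → 2 ≤ c u + c v) → k ≤ ∑ v, c v) (m : ℕ) (hm : 0 < m) :
    Nat.card (H →g tgt β m) * m ^ k ≤
      (3 * Fintype.card β * m ^ 2) ^ Fintype.card α := by
  classical
  have : Finite (H →g tgt β m) := Finite.of_injective (fun φ => (φ : α → _)) DFunLike.coe_injective
  have : Fintype (H →g tgt β m) := Fintype.ofFinite _
  rw [Nat.card_eq_fintype_card, ← Finset.card_univ]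
  let L : (H →g tgt β m) → (α → Fin 3) := fun φ v => ⟨lev m (φ v).2, by
    unfold lev; split_ifs <;> omega⟩
  rw [Finset.card_eq_sum_card_fiberwise (f := L) (t := Finset.univ) (by simp), Finset.sum_mul]
  have hfib : ∀ c : α → Fin 3, (Finset.univ.filter fun φ => L φ = c).card * m ^ k ≤
      (Fintype.card β * m ^ 2) ^ Fintype.card α := by
    intro c
    rcases (Finset.univ.filter fun φ => L φ = c).eq_empty_or_nonempty with h | ⟨φ0, h0⟩
    · rw [h]; simp
    simp only [Finset.mem_filter, Finset.mem_univ, true_and] at h0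
    have hcv : ∀ φ, L φ = c → ∀ v, lev m (φ v).2 = c v := by
      intro φ h v; rw [← h]
    have hcov := hk (fun v => (c v : ℕ)) (by
      intro u v huv
      rw [← hcv φ0 h0, ← hcv φ0 h0]
      exact (φ0.map_rel huv).2)
    have hcard : (Finset.univ.filter fun φ => L φ = c).card ≤
        ∏ v, (Fintype.card β * m ^ (2 - (c v : ℕ))) := by
      have h1 : Fintype.card {φ : H →g tgt β m // L φ = c} ≤
          Fintype.card (∀ v, β × Fin (m ^ (2 - (c v : ℕ)))) := by
        apply Fintype.card_le_of_injective (fun φ v => ((φ.1 v).1,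
          ⟨(φ.1 v).2, lev_lt m _ _ (φ.1 v).2.2 (hcv φ.1 φ.2 v)⟩))
        intro φ ψ h
        apply Subtype.ext
        apply DFunLike.ext
        intro v
        have h2 := congrFun h v
        simp only [Prod.mk.injEq, Fin.mk.injEq] at h2
        exact Prod.ext h2.1 (Fin.ext h2.2)
      rw [Fintype.card_subtype] at h1
      simpa using h1
    calc _ ≤ (∏ v, (Fintype.card β * m ^ (2 - (c v : ℕ)))) * m ^ (∑ v, (c v : ℕ)) :=
          Nat.mul_le_mul hcard (Nat.pow_le_pow_right hm hcov)
      _ = _ := by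
        rw [Finset.prod_mul_distrib, mul_assoc, prod_pow_aux (fun v => (c v : ℕ))
          (fun v => by have := (c v).2; omega), mul_pow]
        simp
  refine (Finset.sum_le_sum fun c _ => hfib c).trans ?_
  simp [mul_pow, mul_assoc]

lemma one_mem_domSet {α β : Type*} [Fintype α] [Fintype β]
    (H₁ : SimpleGraph α) (H₂ : SimpleGraph β)
    (hsub : ∃ f : α → β, Function.Injective f ∧ ∀ x y, H₁.Adj x y → H₂.Adj (f x) (f y)) :
    (1 : ℝ) ∈ domSet H₁ H₂ := by
  classical
  obtain ⟨f, hf, hadj⟩ := hsub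
  refine ⟨zero_le_one, fun n hn T => ?_⟩
  rw [Real.rpow_one]
  unfold homDensity
  have hle := Fintype.card_le_of_injective f hf
  have hn' : (0 : ℝ) < n := by exact_mod_cast hn
  simp only [Fintype.card_fin]
  rw [div_le_div_iff₀ (by positivity) (by positivity)]
  have hc : Fintype.card {b // b ∉ Set.range f} = Fintype.card β - Fintype.card α := by
    rw [Fintype.card_subtype_compl, ← Set.card_range_of_injective hf]
  have : Finite (H₁ →g T) := Finite.of_injective (fun φ => (φ : α → _)) DFunLike.coe_injective
  let F : (H₂ →g T) → (H₁ →g T) × ({b // b ∉ Set.range f} → Fin n) := fun φ =>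
    (⟨fun x => φ (f x), fun {x y} h => φ.map_rel (hadj x y h)⟩, fun b => φ b)
  have hF : Function.Injective F := by
    intro φ ψ h
    apply DFunLike.ext
    intro b
    by_cases hb : b ∈ Set.range f
    · obtain ⟨x, rfl⟩ := hb
      exact congrArg (fun p : (H₁ →g T) × ({b // b ∉ Set.range f} → Fin n) => p.1 x) h
    · exact congrArg (fun p : (H₁ →g T) × ({b // b ∉ Set.range f} → Fin n) => p.2 ⟨b, hb⟩) h
  have h1 := Nat.card_le_card_of_injective F hF
  rw [Nat.card_prod, Nat.card_fun] at h1
  simp only [Nat.card_eq_fintype_card (α := Fin n), Fintype.card_fin,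
    Nat.card_eq_fintype_card (α := {b // b ∉ Set.range f}), hc] at h1
  have h2 : Nat.card (H₂ →g T) * n ^ Fintype.card α ≤ Nat.card (H₁ →g T) * n ^ Fintype.card β := by
    calc _ ≤ _ := Nat.mul_le_mul_right _ h1
      _ = _ := by rw [mul_assoc, ← pow_add, Nat.sub_add_cancel hle]
  exact_mod_cast h2

theorem stmt_16 {α β : Type*} [Fintype α] [Fintype β]
    (H₁ : SimpleGraph α) (H₂ : SimpleGraph β)
    (h₁ : H₁.edgeSet.Nonempty) (h₂ : H₂.edgeSet.Nonempty)
    (hsub : ∃ f : α → β, Function.Injective f ∧ ∀ x y, H₁.Adj x y → H₂.Adj (f x) (f y))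
    (hnu : fracNu H₁ = fracNu H₂) :
    domExp H₁ H₂ = 1 := by
  have hone := one_mem_domSet H₁ H₂ hsub
  unfold domExp
  apply le_antisymm
  · exact csInf_le ⟨0, fun c hc => hc.1⟩ hone
  apply le_csInf ⟨1, hone⟩
  rintro r ⟨hr0, hr⟩
  by_contra! hr1
  obtain ⟨c, hc2, hcov, hcs⟩ := exists_cover H₂
  set k := ∑ v, c v with hkdef
  have hk : ∀ c' : α → ℕ, (∀ u v, H₁.Adj u v → 2 ≤ c' u + c' v) → k ≤ ∑ v, c' v := by
    intro c' h
    have h3 := fracNu_le H₁ c' h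
    have : (k : ℝ) ≤ ((∑ v, c' v : ℕ) : ℝ) := by linarith
    exact_mod_cast this
  obtain ⟨e, he⟩ := h₂
  induction e using Sym2.ind with
  | _ u v =>
  have huv : H₂.Adj u v := he
  have hkpos : 0 < k := by
    by_contra h
    have h0 : ∑ v, c v = 0 := by omega
    rw [Finset.sum_eq_zero_iff] at h0
    have := hcov u v huv
    rw [h0 u (Finset.mem_univ _), h0 v (Finset.mem_univ _)] at this
    omega
  set b := Fintype.card β with hb
  set a := Fintype.card α with ha
  have hbpos : 0 < b := Fintype.card_pos_iff.2 ⟨u⟩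
  have hbR : (0 : ℝ) < b := by exact_mod_cast hbpos
  -- main inequality
  have main : ∀ m : ℕ, 0 < m → (m : ℝ) ^ ((k : ℝ) * (1 - r)) ≤ 3 ^ a * ((b : ℝ) ^ b) ^ r := by
    intro m hm
    have hmR : (0 : ℝ) < m := by exact_mod_cast hm
    have hT := hr (Fintype.card (β × Fin (m ^ 2))) (by
      rw [Fintype.card_prod, Fintype.card_fin]; positivity)
      ((tgt β m).comap (Fintype.equivFin (β × Fin (m ^ 2))).symm)
    rw [homDensity_comap, homDensity_comap] at hT
    have hlow : ((b : ℝ) ^ b)⁻¹ * ((m : ℝ) ^ k)⁻¹ ≤ homDensity H₂ (tgt β m) := by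
      unfold homDensity
      have h3 := hom_lower H₂ c hc2 hcov m hm
      have h4 := prod_pow_aux c hc2 m
      rw [← mul_inv, inv_eq_one_div, div_le_div_iff₀ (by positivity) (by simp; positivity)]
      simp only [Fintype.card_prod, Fintype.card_fin]
      have h5 : (m ^ 2) ^ b ≤ Nat.card (H₂ →g tgt β m) * m ^ k := by
        rw [← h4]; exact Nat.mul_le_mul_right _ h3
      have h6 : ((m : ℝ) ^ 2) ^ b ≤ Nat.card (H₂ →g tgt β m) * (m : ℝ) ^ k := by exact_mod_cast h5
      push_cast
      rw [mul_pow, one_mul]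
      calc (b : ℝ) ^ b * ((m : ℝ) ^ 2) ^ b ≤ (b : ℝ) ^ b * (Nat.card (H₂ →g tgt β m) * (m : ℝ) ^ k) := by
            gcongr
        _ = _ := by ring
    have hup : homDensity H₁ (tgt β m) ≤ 3 ^ a * ((m : ℝ) ^ k)⁻¹ := by
      unfold homDensity
      have h3 := hom_upper (β := β) H₁ k hk m hm
      rw [← div_eq_mul_inv, div_le_div_iff₀ (by simp; positivity) (by positivity)]
      simp only [Fintype.card_prod, Fintype.card_fin]
      have h6 : (Nat.card (H₁ →g tgt β m) : ℝ) * (m : ℝ) ^ k ≤ (3 * b * m ^ 2) ^ a := by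
        exact_mod_cast h3
      push_cast
      refine h6.trans (le_of_eq ?_)
      rw [mul_assoc, mul_pow]
    have h7 : (((b : ℝ) ^ b)⁻¹ * ((m : ℝ) ^ k)⁻¹) ^ r ≤ 3 ^ a * ((m : ℝ) ^ k)⁻¹ :=
      (Real.rpow_le_rpow (by positivity) hlow hr0).trans (hT.trans hup)
    rw [Real.mul_rpow (by positivity) (by positivity), Real.inv_rpow (by positivity),
      Real.inv_rpow (by positivity)] at h7
    have hB : 0 < ((b : ℝ) ^ b) ^ r := by positivity
    have hM : 0 < ((m : ℝ) ^ k) ^ r := by positivity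
    have hK : 0 < (m : ℝ) ^ k := by positivity
    have h8 : (m : ℝ) ^ ((k : ℝ) * (1 - r)) = (m : ℝ) ^ k / ((m : ℝ) ^ k) ^ r := by
      rw [Real.rpow_mul hmR.le, Real.rpow_natCast, Real.rpow_sub hK, Real.rpow_one]
    rw [h8, div_le_iff₀ hM]
    rw [← mul_inv, ← div_eq_mul_inv, inv_eq_one_div, div_le_div_iff₀ (by positivity) hK] at h7
    linarith
  have hpos : 0 < (k : ℝ) * (1 - r) := by
    have : (0 : ℝ) < k := by exact_mod_cast hkpos
    have : 0 < 1 - r := by linarith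
    positivity
  have ht := (tendsto_rpow_atTop hpos).comp (tendsto_natCast_atTop_atTop (R := ℝ))
  obtain ⟨m, hm1, hm2⟩ := ((ht.eventually_gt_atTop (3 ^ a * ((b : ℝ) ^ b) ^ r)).and
    (Filter.eventually_gt_atTop 0)).exists
  exact absurd (main m hm2) (not_le.2 hm1)
end

section
/- C(K_4 − e, K_3) = 2, where K_4 − e is the graph obtained from the complete graph on four vertices by deleting one edge, and K_3 is the triangle. -/
open SimpleGraph

/-- `K_4 - e`: the complete graph on four vertices with one edge deleted. -/
def K4minusE : SimpleGraph (Fin 4) :=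
  (⊤ : SimpleGraph (Fin 4)).deleteEdges {s(0, 1)}

noncomputable instance homFintypeAux {k n : ℕ} (G : SimpleGraph (Fin k)) (T : SimpleGraph (Fin n)) :
    Fintype (G →g T) :=
  @Fintype.ofFinite _ (Finite.of_injective (fun f : G →g T => (f : Fin k → Fin n))
    DFunLike.coe_injective)

lemma k4_adj (i j : Fin 4) (h : K4minusE.Adj i j) :
    i ≠ j ∧ ¬ (i = 0 ∧ j = 1) ∧ ¬ (i = 1 ∧ j = 0) := by
  simp only [K4minusE, deleteEdges_adj, top_adj, Set.mem_singleton_iff, Sym2.eq_iff] at h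
  tauto

lemma k4_adj_of (i j : Fin 4) (h : i ≠ j ∧ ¬ (i = 0 ∧ j = 1) ∧ ¬ (i = 1 ∧ j = 0)) :
    K4minusE.Adj i j := by
  simp only [K4minusE, deleteEdges_adj, top_adj, Set.mem_singleton_iff, Sym2.eq_iff]
  tauto

/-- Glue two triangles along an edge. -/
def glueHom {n : ℕ} {T : SimpleGraph (Fin n)} (f g : (⊤ : SimpleGraph (Fin 3)) →g T)
    (h1 : f 1 = g 1) (h2 : f 2 = g 2) : K4minusE →g T where
  toFun := ![f 0, g 0, f 1, f 2]
  map_rel' := by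
    intro i j hij
    have h := k4_adj i j hij
    have hf : ∀ a b : Fin 3, a ≠ b → T.Adj (f a) (f b) := fun a b hab => f.map_adj hab
    have hg : ∀ a b : Fin 3, a ≠ b → T.Adj (g a) (g b) := fun a b hab => g.map_adj hab
    have g01 := hg 0 1 (by decide)
    have g02 := hg 0 2 (by decide)
    have g10 := hg 1 0 (by decide)
    have g20 := hg 2 0 (by decide)
    rw [← h1] at g01 g10
    rw [← h2] at g02 g20
    fin_cases i <;> fin_cases j <;>
      first
        | (exfalso; revert h; decide)
        | exact g01
        | exact g02
        | exact g10
        | exact g20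
        | exact hf _ _ (by decide)

lemma hom_sq_le {n : ℕ} (T : SimpleGraph (Fin n)) :
    (Fintype.card ((⊤ : SimpleGraph (Fin 3)) →g T)) ^ 2 ≤
      n ^ 2 * Fintype.card (K4minusE →g T) := by
  classical
  let X := (⊤ : SimpleGraph (Fin 3)) →g T
  let π : X → Fin n × Fin n := fun f => (f 1, f 2)
  have hX : Fintype.card X = ∑ p, Fintype.card {f : X // π f = p} := by
    rw [← Fintype.card_sigma]
    exact (Fintype.card_congr (Equiv.sigmaFiberEquiv π)).symm
  have hY : ∑ p, (Fintype.card {f : X // π f = p}) ^ 2 ≤ Fintype.card (K4minusE →g T) := by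
    have : ∑ p, (Fintype.card {f : X // π f = p}) ^ 2 =
        Fintype.card (Σ p, {f : X // π f = p} × {f : X // π f = p}) := by
      simp [Fintype.card_sigma, sq]
    rw [this]
    let F : (Σ p, {f : X // π f = p} × {f : X // π f = p}) → (K4minusE →g T) := fun q =>
      glueHom q.2.1.1 q.2.2.1
        (congrArg Prod.fst (q.2.1.2.trans q.2.2.2.symm))
        (congrArg Prod.snd (q.2.1.2.trans q.2.2.2.symm))
    refine Fintype.card_le_of_injective F ?_
    rintro ⟨p, ⟨f, hf⟩, ⟨g, hg⟩⟩ ⟨p', ⟨f', hf'⟩, ⟨g', hg'⟩⟩ h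
    have h0 : f 0 = f' 0 := DFunLike.congr_fun h 0
    have h1 : g 0 = g' 0 := DFunLike.congr_fun h 1
    have h2 : f 1 = f' 1 := DFunLike.congr_fun h 2
    have h3 : f 2 = f' 2 := DFunLike.congr_fun h 3
    have hfg : π f = π g := hf.trans hg.symm
    have hfg' : π f' = π g' := hf'.trans hg'.symm
    have e1 : f 1 = g 1 := congrArg Prod.fst hfg
    have e2 : f 2 = g 2 := congrArg Prod.snd hfg
    have e1' : f' 1 = g' 1 := congrArg Prod.fst hfg'
    have e2' : f' 2 = g' 2 := congrArg Prod.snd hfg'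
    have hff : f = f' := by
      apply DFunLike.ext
      intro i
      fin_cases i
      exacts [h0, h2, h3]
    have hgg : g = g' := by
      apply DFunLike.ext
      intro i
      fin_cases i
      exacts [h1, e1.symm.trans (h2.trans e1'), e2.symm.trans (h3.trans e2')]
    subst hff hgg hf hf'
    rfl
  have hcs := sq_sum_le_card_mul_sum_sq (s := (Finset.univ : Finset (Fin n × Fin n)))
    (f := fun p => Fintype.card {f : X // π f = p})
  rw [← hX] at hcs
  refine hcs.trans ?_
  have : (Finset.univ : Finset (Fin n × Fin n)).card = n ^ 2 := by simp [sq]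
  rw [this]
  exact Nat.mul_le_mul_left _ hY

lemma card_clique_le {n : ℕ} (T : SimpleGraph (Fin n)) [DecidableRel T.Adj] :
    (T.cliqueFinset 3).card ≤ Fintype.card ((⊤ : SimpleGraph (Fin 3)) →g T) := by
  classical
  rw [← Finset.card_univ]
  refine Finset.card_le_card_of_surjOn
    (fun f : (⊤ : SimpleGraph (Fin 3)) →g T => ({f 0, f 1, f 2} : Finset (Fin n))) ?_
  intro s hs
  rw [Finset.mem_coe, mem_cliqueFinset_iff, is3Clique_iff] at hs
  obtain ⟨a, b, c, hab, hac, hbc, rfl⟩ := hs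
  refine ⟨⟨![a, b, c], ?_⟩, by simp, rfl⟩
  intro i j hij
  fin_cases i <;> fin_cases j <;>
    first
      | (exfalso; exact hij rfl)
      | exact hab
      | exact hac
      | exact hbc
      | exact hab.symm
      | exact hac.symm
      | exact hbc.symm

lemma unique_third {n : ℕ} {T : SimpleGraph (Fin n)} (h : T.EdgeDisjointTriangles)
    {a b c d : Fin n} (hab : T.Adj a b) (hac : T.Adj a c) (hbc : T.Adj b c)
    (had : T.Adj a d) (hbd : T.Adj b d) : c = d := by
  classical
  by_contra hcd
  have h1 : ({a, b, c} : Finset (Fin n)) ∈ T.cliqueSet 3 := by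
    rw [mem_cliqueSet_iff, is3Clique_triple_iff]; exact ⟨hab, hac, hbc⟩
  have h2 : ({a, b, d} : Finset (Fin n)) ∈ T.cliqueSet 3 := by
    rw [mem_cliqueSet_iff, is3Clique_triple_iff]; exact ⟨hab, had, hbd⟩
  have hne : ({a, b, c} : Finset (Fin n)) ≠ {a, b, d} := by
    intro he
    have : c ∈ ({a, b, d} : Finset (Fin n)) := by rw [← he]; simp
    simp only [Finset.mem_insert, Finset.mem_singleton] at this
    rcases this with r | r | r
    · exact hac.ne r.symm
    · exact hbc.ne r.symm
    · exact hcd r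
  exact hab.ne (h h1 h2 hne (by simp) (by simp))

lemma card_k4_le {n : ℕ} (T : SimpleGraph (Fin n)) (h : T.EdgeDisjointTriangles) :
    Fintype.card (K4minusE →g T) ≤ n ^ 2 := by
  have : Fintype.card (Fin n × Fin n) = n ^ 2 := by simp [sq]
  rw [← this]
  refine Fintype.card_le_of_injective (fun f : K4minusE →g T => (f 2, f 3)) ?_
  intro f g hfg
  have e2 : f 2 = g 2 := congrArg Prod.fst hfg
  have e3 : f 3 = g 3 := congrArg Prod.snd hfg
  have a23 : K4minusE.Adj 2 3 := k4_adj_of _ _ (by decide)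
  have a20 : K4minusE.Adj 2 0 := k4_adj_of _ _ (by decide)
  have a30 : K4minusE.Adj 3 0 := k4_adj_of _ _ (by decide)
  have a21 : K4minusE.Adj 2 1 := k4_adj_of _ _ (by decide)
  have a31 : K4minusE.Adj 3 1 := k4_adj_of _ _ (by decide)
  have e0 : f 0 = g 0 := unique_third h (f.map_adj a23) (f.map_adj a20) (f.map_adj a30)
    (by rw [e2]; exact g.map_adj a20) (by rw [e3]; exact g.map_adj a30)
  have e1 : f 1 = g 1 := unique_third h (f.map_adj a23) (f.map_adj a21) (f.map_adj a31)
    (by rw [e2]; exact g.map_adj a21) (by rw [e3]; exact g.map_adj a31)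
  apply DFunLike.ext
  intro i
  fin_cases i
  exacts [e0, e1, e2, e3]

lemma two_mem : (2 : ℝ) ∈ domSet K4minusE (⊤ : SimpleGraph (Fin 3)) := by
  refine ⟨by norm_num, ?_⟩
  intro n hn T
  have h := hom_sq_le T
  have h' : ((Fintype.card ((⊤ : SimpleGraph (Fin 3)) →g T) : ℝ)) ^ 2 ≤
      (n : ℝ) ^ 2 * Fintype.card (K4minusE →g T) := by exact_mod_cast h
  have hn' : (0 : ℝ) < n := by exact_mod_cast hn
  rw [Real.rpow_two]
  simp only [homDensity, Nat.card_eq_fintype_card, Fintype.card_fin]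
  rw [div_pow, div_le_div_iff₀ (by positivity) (by positivity)]
  calc _ ≤ ((n : ℝ) ^ 2 * Fintype.card (K4minusE →g T)) * (n : ℝ) ^ 4 := by gcongr
    _ = _ := by ring

lemma le_of_mem (c : ℝ) (hc : c ∈ domSet K4minusE (⊤ : SimpleGraph (Fin 3))) : 2 ≤ c := by
  classical
  obtain ⟨hc0, hc⟩ := hc
  by_contra hlt
  push Not at hlt
  obtain ⟨C, hC, hb⟩ := ruzsaSzemerediNumberNat_asymptotic_lower_bound.exists_pos
  have hb := hb.bound
  have hL : Filter.Tendsto (fun n : ℕ => Real.sqrt (Real.log n)) Filter.atTop Filter.atTop :=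
    Real.tendsto_sqrt_atTop.comp (Real.tendsto_log_atTop.comp tendsto_natCast_atTop_atTop)
  obtain ⟨n, ⟨hbn, hsn⟩, hn1⟩ := ((hb.and (hL.eventually_gt_atTop
    ((4 * c + c * |Real.log C|) / (2 - c) + 1))).and (Filter.eventually_ge_atTop 1)).exists
  obtain ⟨T, _, hT, hLL⟩ := ruzsaSzemerediNumber_spec (α := Fin n)
  have hn0 : (0 : ℝ) < n := by exact_mod_cast hn1
  have hk4 : (Fintype.card (K4minusE →g T) : ℝ) ≤ (n : ℝ) ^ 2 := by
    exact_mod_cast card_k4_le T hLL.1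
  have hk3 : (ruzsaSzemerediNumberNat n : ℝ) ≤ Fintype.card ((⊤ : SimpleGraph (Fin 3)) →g T) := by
    have := card_clique_le T
    rw [ruzsaSzemerediNumberNat, ← hT]
    exact_mod_cast this
  rw [Real.norm_of_nonneg (by positivity), Real.norm_of_nonneg (by positivity)] at hbn
  have hmain := hc n hn1 T
  simp only [homDensity, Nat.card_eq_fintype_card, Fintype.card_fin] at hmain
  set s := Real.sqrt (Real.log n) with hs
  have hlog : Real.log n = s ^ 2 :=
    (Real.sq_sqrt (Real.log_nonneg (by exact_mod_cast hn1))).symm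
  have hlow : Real.exp (-4 * s) / (C * n) ≤
      (Fintype.card ((⊤ : SimpleGraph (Fin 3)) →g T) : ℝ) / (n : ℝ) ^ 3 := by
    rw [div_le_div_iff₀ (by positivity) (by positivity)]
    calc _ = ((n : ℝ) ^ 2 * Real.exp (-4 * s)) * n := by ring
      _ ≤ (C * ruzsaSzemerediNumberNat n) * n := by gcongr
      _ ≤ (C * Fintype.card ((⊤ : SimpleGraph (Fin 3)) →g T)) * n := by gcongr
      _ = _ := by ring
  have hup : (Fintype.card (K4minusE →g T) : ℝ) / (n : ℝ) ^ 4 ≤ 1 / (n : ℝ) ^ 2 := by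
    rw [div_le_div_iff₀ (by positivity) (by positivity)]
    calc _ ≤ (n : ℝ) ^ 2 * (n : ℝ) ^ 2 := by gcongr
      _ = _ := by ring
  have hall : (Real.exp (-4 * s) / (C * n)) ^ c ≤ 1 / (n : ℝ) ^ 2 :=
    (Real.rpow_le_rpow (by positivity) hlow hc0).trans (hmain.trans hup)
  have hl := Real.log_le_log (by positivity) hall
  rw [Real.log_rpow (by positivity), Real.log_div (Real.exp_pos _).ne' (by positivity),
    Real.log_exp, Real.log_mul hC.ne' hn0.ne', one_div, Real.log_inv, Real.log_pow, hlog] at hl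
  push_cast at hl
  have h2c : 0 < 2 - c := by linarith
  have hK : 0 ≤ (4 * c + c * |Real.log C|) / (2 - c) := by positivity
  have hs1 : 1 < s := by linarith
  have h3 : 4 * c + c * |Real.log C| < (2 - c) * s := by
    have : (4 * c + c * |Real.log C|) / (2 - c) < s := by linarith
    rw [div_lt_iff₀ h2c] at this
    linarith
  have h4 : (4 * c + c * |Real.log C|) * s < (2 - c) * s * s := by
    apply mul_lt_mul_of_pos_right h3; linarith
  have h5 : c * Real.log C ≤ c * |Real.log C| :=
    mul_le_mul_of_nonneg_left (le_abs_self _) hc0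
  have h6 : c * |Real.log C| ≤ c * |Real.log C| * s :=
    le_mul_of_one_le_right (by positivity) hs1.le
  nlinarith

theorem stmt_17 : domExp K4minusE (⊤ : SimpleGraph (Fin 3)) = 2 := by
  have h : IsLeast (domSet K4minusE (⊤ : SimpleGraph (Fin 3))) 2 :=
    ⟨two_mem, fun c hc => le_of_mem c hc⟩
  exact h.csInf_eq
end
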